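/- arXiv:1604.00216 — 3 statements merged into one kernel-verified Lean document; each statement's English description precedes it below -/
import Mathlib

section
/- Let α, β be Martin-Löf random left-c.e. reals. If D(α,β) = 1, then α − β is not Martin-Löf random. -/
open Filter MeasureTheory Set

/-- A real is left-c.e. if it is the limit of a computable increasing sequence of rationals. -/
def LeftCE (x : ℝ) : Prop :=
  ∃ f : ℕ → ℚ, Computable f ∧ Monotone f ∧
    Tendsto (fun n => (f n : ℝ)) atTop (nhds x)

/-- A real is right-c.e. if it is the limit of a computable decreasing sequence of rationals. -/
def RightCE (x : ℝ) : Prop :=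
  ∃ f : ℕ → ℚ, Computable f ∧ Antitone f ∧
    Tendsto (fun n => (f n : ℝ)) atTop (nhds x)

/-- The Σ⁰₁ class of reals given by level `i` of the computable enumeration `g` of
rational open intervals. -/
def testSet (g : ℕ → ℕ → ℚ × ℚ) (i : ℕ) : Set ℝ :=
  ⋃ n, Set.Ioo (((g i n).1 : ℝ)) (((g i n).2 : ℝ))

/-- A real is Martin-Löf random if for every Martin-Löf test, i.e. every uniformly c.e.
sequence of Σ⁰₁ classes `(U_i)` with `μ(U_i) ≤ 2⁻¹ ^ i`, the real avoids some level of
the test. -/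
def MLRandom (x : ℝ) : Prop :=
  ∀ g : ℕ → ℕ → ℚ × ℚ, Computable₂ g →
    (∀ i, volume (testSet g i) ≤ 2⁻¹ ^ i) →
    ∃ i, x ∉ testSet g i

/-- `DD α β` is the infimum of the positive rationals `q` such that `qα - β` is a
left-c.e. real. -/
noncomputable def DD (a b : ℝ) : ℝ :=
  sInf {x : ℝ | ∃ q : ℚ, 0 < q ∧ x = (q : ℝ) ∧ LeftCE ((q : ℝ) * a - b)}

/-- `DDstar α β` is the supremum of the positive rationals `q` such that `qα - β` is a
right-c.e. real. -/
noncomputable def DDstar (a b : ℝ) : ℝ :=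
  sSup {x : ℝ | ∃ q : ℚ, 0 < q ∧ x = (q : ℝ) ∧ RightCE ((q : ℝ) * a - b)}

open Encodable in
instance i1 : DecidablePred (· ∈ Set.range (@encode ℚ Rat.instEncodable)) := @decidableRangeEncode ℚ Rat.instEncodable

open Encodable in
instance i2 : Infinite (Set.range (@encode ℚ Rat.instEncodable)) :=
  Infinite.of_injective _ (Equiv.ofInjective _ (@encode_injective ℚ Rat.instEncodable)).injective

/-- raw code -/
def E0 (q : ℚ) : ℕ := @Encodable.encode ℚ Rat.instEncodable q

open Encodable in
theorem E0_ofNat (n : ℕ) : E0 (@Denumerable.ofNat ℚ Rat.instDenumerable n) =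
    (Nat.Subtype.ofNat (Set.range (@encode ℚ Rat.instEncodable)) n : ℕ) := by
  have : (@Denumerable.ofNat ℚ Rat.instDenumerable n) =
    (equivRangeEncode ℚ).symm (Nat.Subtype.ofNat (Set.range (@encode ℚ Rat.instEncodable)) n) := by
    rfl
  rw [this]
  have := (equivRangeEncode ℚ).apply_symm_apply
    (Nat.Subtype.ofNat (Set.range (@encode ℚ Rat.instEncodable)) n)
  exact congrArg Subtype.val this

theorem E0_eq (q : ℚ) : E0 q = Nat.pair (Equiv.intEquivNat q.num) q.den := rfl

theorem int_pos (k : ℕ) : (Equiv.intEquivNat.symm k) =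
    (if k % 2 = 0 then ((k / 2 : ℕ) : ℤ) else - (((k + 1) / 2 : ℕ) : ℤ)) := by
  rw [Equiv.symm_apply_eq]
  split_ifs with h
  · obtain ⟨j, rfl⟩ : ∃ j, k = 2 * j := ⟨k / 2, by omega⟩
    have : 2 * j / 2 = j := by omega
    rw [this]
    rfl
  · obtain ⟨j, rfl⟩ : ∃ j, k = 2 * j + 1 := ⟨k / 2, by omega⟩
    have : (2 * j + 1 + 1)/ 2 = j + 1 := by omega
    rw [this, Nat.cast_succ, ← Int.negSucc_eq]
    rfl

theorem int_abs (k : ℕ) : (Equiv.intEquivNat.symm k).natAbs = (k + 1) / 2 := by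
  rw [int_pos]; split_ifs <;> omega

theorem mem_S0 (m : ℕ) : m ∈ Set.range E0 ↔
    0 < m.unpair.2 ∧ ∀ k < m.unpair.2 + 1, (((m.unpair.1 + 1) / 2) % k = 0 ∧ m.unpair.2 % k = 0) → k = 1 := by
  have hco : ∀ a b : ℕ, 0 < b → (a.Coprime b ↔ ∀ k < b + 1, (a % k = 0 ∧ b % k = 0) → k = 1) := by
    intro a b hb
    constructor
    · rintro h k - ⟨h1, h2⟩
      exact Nat.eq_one_of_dvd_coprimes h (Nat.dvd_of_mod_eq_zero h1) (Nat.dvd_of_mod_eq_zero h2)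
    · intro h
      apply h
      · exact Nat.lt_succ_of_le (Nat.gcd_le_right _ hb)
      · exact ⟨Nat.mod_eq_zero_of_dvd (Nat.gcd_dvd_left _ _), Nat.mod_eq_zero_of_dvd (Nat.gcd_dvd_right _ _)⟩
  constructor
  · rintro ⟨q, rfl⟩
    rw [E0_eq]
    simp only [Nat.unpair_pair]
    refine ⟨q.den_pos, ?_⟩
    rw [← hco _ _ q.den_pos, ← int_abs, Equiv.symm_apply_apply]
    exact q.reduced
  · rintro ⟨h1, h2⟩
    rw [← hco _ _ h1, ← int_abs] at h2
    refine ⟨⟨Equiv.intEquivNat.symm m.unpair.1, m.unpair.2, h1.ne', h2⟩, ?_⟩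
    rw [E0_eq]
    simp

theorem S0_primrec : PrimrecPred (fun m => m ∈ Set.range E0) := by
  have hR : PrimrecRel (fun (k : ℕ) (m : ℕ) => (((m.unpair.1 + 1) / 2) % k = 0 ∧ m.unpair.2 % k = 0) → k = 1) := by
    have u1 : Primrec (fun p : ℕ × ℕ => p.2.unpair.1) := Primrec.fst.comp (Primrec.unpair.comp Primrec.snd)
    have u2 : Primrec (fun p : ℕ × ℕ => p.2.unpair.2) := Primrec.snd.comp (Primrec.unpair.comp Primrec.snd)
    have h1 : PrimrecPred (fun p : ℕ × ℕ => ((p.2.unpair.1 + 1) / 2) % p.1 = 0) :=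
      Primrec.eq.comp (Primrec.nat_mod.comp (Primrec.nat_div.comp (Primrec.succ.comp u1) (Primrec.const 2)) Primrec.fst) (Primrec.const 0)
    have h2 : PrimrecPred (fun p : ℕ × ℕ => p.2.unpair.2 % p.1 = 0) :=
      Primrec.eq.comp (Primrec.nat_mod.comp u2 Primrec.fst) (Primrec.const 0)
    have h3 : PrimrecPred (fun p : ℕ × ℕ => p.1 = 1) := Primrec.eq.comp Primrec.fst (Primrec.const 1)
    exact PrimrecPred.primrecRel (p := fun p : ℕ × ℕ => (((p.2.unpair.1 + 1) / 2) % p.1 = 0 ∧ p.2.unpair.2 % p.1 = 0) → p.1 = 1) (((h1.and h2).not.or h3).of_eq (fun p => by tauto))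
  have u2 : Primrec (fun m : ℕ => m.unpair.2) := Primrec.snd.comp Primrec.unpair
  have h1 : PrimrecPred (fun m : ℕ => ∀ k < m.unpair.2 + 1, (((m.unpair.1 + 1) / 2) % k = 0 ∧ m.unpair.2 % k = 0) → k = 1) :=
    hR.forall_lt.comp (Primrec.succ.comp u2) Primrec.id
  have h2 : PrimrecPred (fun m : ℕ => 0 < m.unpair.2) := Primrec.nat_lt.comp (Primrec.const 0) u2
  exact (h2.and h1).of_eq (fun m => (mem_S0 m).symm)

theorem c_comp : Computable (fun n : ℕ => E0 (Denumerable.ofNat ℚ n)) := by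
  classical
  have hex : ∀ x : ℕ, ∃ k, x + k + 1 ∈ Set.range E0 := by
    intro x
    have : (Set.range E0).Infinite := Set.infinite_coe_iff.1 i2
    obtain ⟨y, hy, hxy⟩ := this.exists_gt x
    exact ⟨y - x - 1, by convert hy using 1; omega⟩
  have hfind : Computable (fun x => Nat.find (hex x)) := by
    apply Computable.find
    apply PrimrecPred.computablePred
    exact S0_primrec.comp (Primrec.succ.comp (Primrec.nat_add.comp Primrec.fst Primrec.snd))
  have hnext : Computable (fun x => x + Nat.find (hex x) + 1) :=
    Computable.succ.comp (Primrec.nat_add.to_comp.comp Computable.id hfind)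
  have hrec : Computable (fun n : ℕ => Nat.rec (motive := fun _ => ℕ) (E0 (Denumerable.ofNat ℚ 0)) (fun _ x => x + Nat.find (hex x) + 1) n) :=
    Computable.nat_rec (f := fun n : ℕ => n) (g := fun _ => E0 (Denumerable.ofNat ℚ 0))
      (h := fun _ p => p.2 + Nat.find (hex p.2) + 1) Computable.id (Computable.const _)
      (hnext.comp (Computable.snd.comp Computable.snd)).to₂
  refine hrec.of_eq ?_
  intro n
  induction n with
  | zero => rfl
  | succ n ih =>
    simp only at ih ⊢
    rw [ih]
    simp only [E0_ofNat]
    simp only [Nat.Subtype.ofNat, Nat.Subtype.succ]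
    congr

theorem ofNat_enc (q : ℚ) : Denumerable.ofNat ℚ (@Encodable.encode ℚ (@Denumerable.toEncodable ℚ Rat.instDenumerable) q) = q :=
  @Denumerable.ofNat_encode ℚ Rat.instDenumerable q

theorem E0_comp : Computable E0 := by
  have := c_comp.comp (Computable.encode (α := ℚ))
  exact this.of_eq (fun q => congrArg E0 (ofNat_enc q))

/-- parts -/
def rP (q : ℚ) : ℕ := q.num.toNat
/-- parts -/
def rM (q : ℚ) : ℕ := (-q.num).toNat

theorem int_toNat (z : ℤ) : z.toNat = if (Equiv.intEquivNat z) % 2 = 0 then (Equiv.intEquivNat z) / 2 else 0 := by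
  obtain ⟨k, rfl⟩ := Equiv.intEquivNat.symm.surjective z
  rw [Equiv.apply_symm_apply, int_pos]
  split_ifs <;> omega

theorem int_toNat' (z : ℤ) : (-z).toNat = if (Equiv.intEquivNat z) % 2 = 0 then 0 else (Equiv.intEquivNat z + 1) / 2 := by
  obtain ⟨k, rfl⟩ := Equiv.intEquivNat.symm.surjective z
  rw [Equiv.apply_symm_apply, int_pos]
  split_ifs <;> omega

theorem rP_comp : Computable rP := by
  have u1 : Primrec (fun m : ℕ => m.unpair.1) := Primrec.fst.comp Primrec.unpair
  have : Primrec (fun m : ℕ => if m.unpair.1 % 2 = 0 then m.unpair.1 / 2 else 0) :=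
    Primrec.ite (Primrec.eq.comp (Primrec.nat_mod.comp u1 (Primrec.const 2)) (Primrec.const 0))
      (Primrec.nat_div.comp u1 (Primrec.const 2)) (Primrec.const 0)
  refine (this.to_comp.comp E0_comp).of_eq ?_
  intro q
  simp only [E0_eq, Nat.unpair_pair, rP, int_toNat]

theorem rM_comp : Computable rM := by
  have u1 : Primrec (fun m : ℕ => m.unpair.1) := Primrec.fst.comp Primrec.unpair
  have : Primrec (fun m : ℕ => if m.unpair.1 % 2 = 0 then 0 else (m.unpair.1 + 1) / 2) :=
    Primrec.ite (Primrec.eq.comp (Primrec.nat_mod.comp u1 (Primrec.const 2)) (Primrec.const 0))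
      (Primrec.const 0) (Primrec.nat_div.comp (Primrec.succ.comp u1) (Primrec.const 2))
  refine (this.to_comp.comp E0_comp).of_eq ?_
  intro q
  simp only [E0_eq, Nat.unpair_pair, rM, int_toNat']

theorem den_comp : Computable (fun q : ℚ => q.den) := by
  have u1 : Primrec (fun m : ℕ => m.unpair.2) := Primrec.snd.comp Primrec.unpair
  refine (u1.to_comp.comp E0_comp).of_eq ?_
  intro q
  simp only [E0_eq, Nat.unpair_pair]

theorem rat_eq (q : ℚ) : q = ((rP q : ℚ) - rM q) / q.den := by
  have h : ((rP q : ℤ) - rM q) = q.num := by unfold rP rM; omega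
  have h' : ((rP q : ℚ) - rM q) = q.num := by exact_mod_cast congrArg (Int.cast : ℤ → ℚ) h
  rw [h', Rat.num_div_den]

theorem cross_iff (q : ℚ) (a b d : ℕ) : rP q * (d+1) + b * q.den = a * q.den + rM q * (d+1) ↔
    q = ((a : ℚ) - b) / ((d : ℚ) + 1) := by
  have h1 : (q.den : ℚ) ≠ 0 := by exact_mod_cast q.den_nz
  have h2 : ((d : ℚ) + 1) ≠ 0 := by positivity
  conv_rhs => rw [rat_eq q]
  rw [div_eq_div_iff h1 h2]
  constructor
  · intro h
    have := congrArg (Nat.cast : ℕ → ℚ) h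
    push_cast at this
    linarith
  · intro h
    have : ((rP q * (d+1) + b * q.den : ℕ) : ℚ) = ((a * q.den + rM q * (d+1) : ℕ) : ℚ) := by
      push_cast; linarith
    exact_mod_cast this

theorem mk_comp : Computable (fun p : ℕ × ℕ × ℕ => ((p.1 : ℚ) - p.2.1) / ((p.2.2 : ℚ) + 1)) := by
  classical
  have hex : ∀ p : ℕ × ℕ × ℕ, ∃ n : ℕ, rP (Denumerable.ofNat ℚ n) * (p.2.2 + 1) + p.2.1 * (Denumerable.ofNat ℚ n).den
      = p.1 * (Denumerable.ofNat ℚ n).den + rM (Denumerable.ofNat ℚ n) * (p.2.2 + 1) := by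
    intro p
    refine ⟨@Encodable.encode ℚ (@Denumerable.toEncodable ℚ Rat.instDenumerable) (((p.1 : ℚ) - p.2.1) / ((p.2.2 : ℚ) + 1)), ?_⟩
    rw [ofNat_enc, cross_iff]
  have hfind : Computable (fun p => Nat.find (hex p)) := by
    apply Computable.find
    have o : Computable (fun p : (ℕ × ℕ × ℕ) × ℕ => Denumerable.ofNat ℚ p.2) :=
      (Computable.ofNat ℚ).comp Computable.snd
    have p1 : Computable (fun p : (ℕ × ℕ × ℕ) × ℕ => p.1.1) := Computable.fst.comp Computable.fst
    have p2 : Computable (fun p : (ℕ × ℕ × ℕ) × ℕ => p.1.2.1) :=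
      Computable.fst.comp (Computable.snd.comp Computable.fst)
    have p3 : Computable (fun p : (ℕ × ℕ × ℕ) × ℕ => p.1.2.2 + 1) :=
      Computable.succ.comp (Computable.snd.comp (Computable.snd.comp Computable.fst))
    have add := Primrec.nat_add.to_comp
    have mul := Primrec.nat_mul.to_comp
    have eqc : Computable₂ (fun a b : ℕ => decide (a = b)) := by
      exact (Primrec.eq (α := ℕ)).decide.to_comp
    have := eqc.comp (add.comp (mul.comp (rP_comp.comp o) p3) (mul.comp p2 (den_comp.comp o)))
      (add.comp (mul.comp p1 (den_comp.comp o)) (mul.comp (rM_comp.comp o) p3))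
    rw [ComputablePred.computable_iff]
    exact ⟨_, this, by funext p; simp⟩
  refine ((Computable.ofNat ℚ).comp hfind).of_eq ?_
  intro p
  exact (cross_iff _ _ _ _).1 (Nat.find_spec (hex p))

theorem rat_op2 {A : Type*} [Primcodable A] {f : A → ℚ} {a b d : A → ℕ} (ha : Computable a) (hb : Computable b)
    (hd : Computable d) (hd0 : ∀ x, 0 < d x) (h : ∀ x, f x = ((a x : ℚ) - b x) / d x) : Computable f := by
  refine (mk_comp.comp (ha.pair (hb.pair (Computable.pred.comp hd)))).of_eq ?_
  intro x
  rw [h]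
  have : (((d x).pred : ℕ) : ℚ) + 1 = d x := by
    have := Nat.succ_pred_eq_of_pos (hd0 x)
    exact_mod_cast this
  simp only [this]

section ops
variable {A : Type*} [Primcodable A] {f g : A → ℚ}

theorem cadd (hf : Computable f) (hg : Computable g) : Computable (fun x => f x + g x) := by
  have add := Primrec.nat_add.to_comp
  have mul := Primrec.nat_mul.to_comp
  have df := den_comp.comp hf
  have dg := den_comp.comp hg
  refine rat_op2 (add.comp (mul.comp (rP_comp.comp hf) dg) (mul.comp (rP_comp.comp hg) df))
    (add.comp (mul.comp (rM_comp.comp hf) dg) (mul.comp (rM_comp.comp hg) df)) (mul.comp df dg)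
    (fun x => Nat.mul_pos (f x).den_pos (g x).den_pos) ?_
  intro x
  have h1 : ((f x).den : ℚ) ≠ 0 := by exact_mod_cast (f x).den_nz
  have h2 : ((g x).den : ℚ) ≠ 0 := by exact_mod_cast (g x).den_nz
  conv_lhs => rw [rat_eq (f x), rat_eq (g x)]
  push_cast
  field_simp
  ring

theorem cmul (hf : Computable f) (hg : Computable g) : Computable (fun x => f x * g x) := by
  have add := Primrec.nat_add.to_comp
  have mul := Primrec.nat_mul.to_comp
  have df := den_comp.comp hf
  have dg := den_comp.comp hg
  refine rat_op2 (add.comp (mul.comp (rP_comp.comp hf) (rP_comp.comp hg)) (mul.comp (rM_comp.comp hf) (rM_comp.comp hg)))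
    (add.comp (mul.comp (rP_comp.comp hf) (rM_comp.comp hg)) (mul.comp (rM_comp.comp hf) (rP_comp.comp hg))) (mul.comp df dg)
    (fun x => Nat.mul_pos (f x).den_pos (g x).den_pos) ?_
  intro x
  have h1 : ((f x).den : ℚ) ≠ 0 := by exact_mod_cast (f x).den_nz
  have h2 : ((g x).den : ℚ) ≠ 0 := by exact_mod_cast (g x).den_nz
  conv_lhs => rw [rat_eq (f x), rat_eq (g x)]
  push_cast
  field_simp
  ring

theorem cneg (hf : Computable f) : Computable (fun x => - f x) :=
  (cmul (Computable.const (-1)) hf).of_eq (fun x => by simp)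

theorem csub (hf : Computable f) (hg : Computable g) : Computable (fun x => f x - g x) :=
  (cadd hf (cneg hg)).of_eq (fun x => by ring)

theorem cle (hf : Computable f) (hg : Computable g) : Computable (fun x => decide (f x ≤ g x)) := by
  have add := Primrec.nat_add.to_comp
  have mul := Primrec.nat_mul.to_comp
  have df := den_comp.comp hf
  have dg := den_comp.comp hg
  have lec : Computable₂ (fun a b : ℕ => decide (a ≤ b)) := Primrec.nat_le.decide.to_comp
  refine (lec.comp (add.comp (mul.comp (rP_comp.comp hf) dg) (mul.comp (rM_comp.comp hg) df))
    (add.comp (mul.comp (rM_comp.comp hf) dg) (mul.comp (rP_comp.comp hg) df))).of_eq ?_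
  intro x
  have h1 : (0 : ℚ) < ((f x).den : ℚ) := by exact_mod_cast (f x).den_pos
  have h2 : (0 : ℚ) < ((g x).den : ℚ) := by exact_mod_cast (g x).den_pos
  apply decide_eq_decide.2
  conv_rhs => rw [rat_eq (f x), rat_eq (g x)]
  rw [div_le_div_iff₀ h1 h2, ← Nat.cast_le (α := ℚ)]
  push_cast
  constructor <;> intro h <;> linarith

theorem cmax (hf : Computable f) (hg : Computable g) : Computable (fun x => max (f x) (g x)) :=
  (Computable.cond (cle hf hg) hg hf).of_eq (fun x => by
    by_cases h : f x ≤ g x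
    · simp [h]
    · simp [h, le_of_not_ge h])

theorem cmin (hf : Computable f) (hg : Computable g) : Computable (fun x => min (f x) (g x)) :=
  (Computable.cond (cle hf hg) hf hg).of_eq (fun x => by
    by_cases h : f x ≤ g x
    · simp [h]
    · simp [h, le_of_not_ge h])

theorem chalf {n : A → ℕ} (hn : Computable n) : Computable (fun x => ((2 : ℚ)⁻¹) ^ n x) := by
  have h : Computable (fun n : ℕ => ((2 : ℚ)⁻¹) ^ n) := by
    have : Computable (fun n : ℕ => Nat.rec (motive := fun _ => ℚ) 1 (fun _ x => x * 2⁻¹) n) :=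
      Computable.nat_rec (f := fun n : ℕ => n) (g := fun _ => (1 : ℚ))
        (h := fun _ p => p.2 * 2⁻¹) Computable.id (Computable.const _)
        (cmul (Computable.snd.comp Computable.snd) (Computable.const _)).to₂
    refine this.of_eq (fun n => ?_)
    induction n with
    | zero => simp
    | succ n ih => simp only at ih ⊢; rw [ih, pow_succ]
  exact h.comp hn
end ops

theorem leftCE_add {x y : ℝ} (hx : LeftCE x) (hy : LeftCE y) : LeftCE (x + y) := by
  obtain ⟨f, hf, mf, tf⟩ := hx
  obtain ⟨g, hg, mg, tg⟩ := hy
  refine ⟨fun n => f n + g n, cadd hf hg, mf.add mg, ?_⟩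
  push_cast
  exact tf.add tg

theorem leftCE_smul {x : ℝ} (hx : LeftCE x) (c : ℚ) (hc : 0 ≤ c) : LeftCE ((c : ℝ) * x) := by
  obtain ⟨f, hf, mf, tf⟩ := hx
  refine ⟨fun n => c * f n, cmul (Computable.const c) hf, fun m n h => mul_le_mul_of_nonneg_left (mf h) hc, ?_⟩
  push_cast
  exact tf.const_mul _

theorem approx_le {x : ℝ} {f : ℕ → ℚ} (mf : Monotone f)
    (tf : Tendsto (fun n => (f n : ℝ)) atTop (nhds x)) (n : ℕ) : (f n : ℝ) ≤ x := by
  have : Monotone (fun n => (f n : ℝ)) := fun m n h => Rat.cast_le.2 (mf h)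
  exact this.ge_of_tendsto tf n

theorem not_random_of_both {x : ℝ} (hx : LeftCE x) (hy : LeftCE (-x)) : ¬ MLRandom x := by
  obtain ⟨f, hf, mf, tf⟩ := hx
  obtain ⟨g, hg, mg, tg⟩ := hy
  intro hr
  have lf := approx_le mf tf
  have lg := approx_le mg tg
  let t : ℕ → ℕ → ℚ × ℚ := fun i n =>
    bif decide (- g n - f n ≤ (2⁻¹ : ℚ) ^ (i + 2)) then (f n - (2⁻¹ : ℚ) ^ (i + 2), - g n + (2⁻¹ : ℚ) ^ (i + 2))
      else (0, 0)
  have ht : Computable₂ t := by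
    have f' : Computable (fun p : ℕ × ℕ => f p.2) := hf.comp Computable.snd
    have g' : Computable (fun p : ℕ × ℕ => - g p.2) := cneg (hg.comp Computable.snd)
    have e : Computable (fun p : ℕ × ℕ => (2⁻¹ : ℚ) ^ (p.1 + 2)) :=
      chalf (Computable.succ.comp (Computable.succ.comp Computable.fst))
    exact Computable.cond (cle (csub g' f') e) ((csub f' e).pair (cadd g' e)) (Computable.const (0, 0))
  obtain ⟨i, hi⟩ := hr t ht (by
    intro i
    have hsub : testSet t i ⊆ Set.Ioo (x - (2⁻¹ : ℝ) ^ (i + 1)) (x + (2⁻¹ : ℝ) ^ (i + 1)) := by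
      apply Set.iUnion_subset
      intro n y hy
      simp only [t] at hy
      by_cases h : - g n - f n ≤ (2⁻¹ : ℚ) ^ (i + 2)
      · simp only [h, decide_true, cond_true] at hy
        have h' : (- g n - f n : ℝ) ≤ (2⁻¹ : ℝ) ^ (i + 2) := by
          have := (Rat.cast_le (K := ℝ)).2 h
          push_cast at this
          exact this
        obtain ⟨h1, h2⟩ := hy
        push_cast at h1 h2
        have := lf n
        have := lg n
        have e : (2⁻¹ : ℝ) ^ (i + 1) = (2⁻¹ : ℝ) ^ (i + 2) + (2⁻¹ : ℝ) ^ (i + 2) := by ring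
        constructor <;> linarith
      · simp only [h, decide_false, cond_false] at hy
        exact absurd (hy.1.trans hy.2) (lt_irrefl _)
    refine (measure_mono hsub).trans ?_
    rw [Real.volume_Ioo]
    have e : x + (2⁻¹ : ℝ) ^ (i + 1) - (x - (2⁻¹ : ℝ) ^ (i + 1)) = (2⁻¹ : ℝ) ^ i := by ring
    rw [e, ENNReal.ofReal_pow (by norm_num), ENNReal.ofReal_inv_of_pos (by norm_num)]
    simp)
  apply hi
  have hlim : Tendsto (fun n => - (g n : ℝ) - f n) atTop (nhds (- - x - x)) := tg.neg.sub tf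
  have hpos : (0 : ℝ) < (2⁻¹ : ℝ) ^ (i + 2) := by positivity
  have hev := hlim.eventually_lt_const (u := (2⁻¹ : ℝ) ^ (i + 2)) (by simpa using hpos)
  obtain ⟨n, hn⟩ := hev.exists
  have h : - g n - f n ≤ (2⁻¹ : ℚ) ^ (i + 2) := by
    have := hn.le
    rw [← Rat.cast_le (K := ℝ)]
    push_cast
    exact this
  refine Set.mem_iUnion.2 ⟨n, ?_⟩
  simp only [t, h, decide_true, cond_true]
  have := lf n
  have := lg n
  push_cast
  constructor <;> linarith

theorem random_irr {x : ℝ} (hx : MLRandom x) (q : ℚ) : x ≠ q := by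
  rintro rfl
  have hc : ∀ q : ℚ, LeftCE (q : ℝ) := fun q =>
    ⟨fun _ => q, Computable.const q, monotone_const, tendsto_const_nhds⟩
  exact not_random_of_both (hc q) (by simpa using hc (-q)) hx

theorem random_neg {x : ℝ} (hx : MLRandom x) : MLRandom (-x) := by
  intro g hg hm
  let g' : ℕ → ℕ → ℚ × ℚ := fun i n => (- (g i n).2, - (g i n).1)
  have hset : ∀ i, testSet g' i = Neg.neg ⁻¹' (testSet g i) := by
    intro i
    ext y
    simp only [testSet, g', Set.mem_iUnion, Set.mem_preimage, Set.mem_Ioo]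
    push_cast
    constructor
    · rintro ⟨n, h1, h2⟩; exact ⟨n, by linarith, by linarith⟩
    · rintro ⟨n, h1, h2⟩; exact ⟨n, by linarith, by linarith⟩
  have hg' : Computable₂ g' := by
    have hg0 : Computable (fun p : ℕ × ℕ => g p.1 p.2) := hg
    exact (cneg (Computable.snd.comp hg0)).pair (cneg (Computable.fst.comp hg0))
  obtain ⟨i, hi⟩ := hx g' hg' (fun i => by
    rw [hset, Measure.measure_preimage_neg]; exact hm i)
  refine ⟨i, fun h => hi ?_⟩
  rw [hset]
  exact h

/-- greedy sequence -/
def rr (c a : ℕ → ℚ) (e : ℚ) (n : ℕ) : ℚ :=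
  Nat.rec (motive := fun _ => ℚ) (c 0) (fun s r => max r (c s) + e * (a (s + 1) - a s)) n

theorem rr_succ (c a : ℕ → ℚ) (e : ℚ) (s : ℕ) :
    rr c a e (s + 1) = max (rr c a e s) (c s) + e * (a (s + 1) - a s) := rfl

theorem rr_comp {A : Type*} [Primcodable A] {c a : ℕ → ℚ} (hc : Computable c) (ha : Computable a)
    {e : A → ℚ} {n : A → ℕ} (he : Computable e) (hn : Computable n) :
    Computable (fun x => rr c a (e x) (n x)) := by
  refine Computable.nat_rec (f := n) (g := fun _ => c 0)
    (h := fun x p => max p.2 (c p.1) + e x * (a (p.1 + 1) - a p.1)) hn (Computable.const _) ?_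
  have p1 : Computable (fun y : A × ℕ × ℚ => y.2.1) := Computable.fst.comp Computable.snd
  have p2 : Computable (fun y : A × ℕ × ℚ => y.2.2) := Computable.snd.comp Computable.snd
  exact cadd (cmax p2 (hc.comp p1)) (cmul (he.comp Computable.fst) (csub (ha.comp (Computable.succ.comp p1)) (ha.comp p1)))

theorem ks {c a : ℝ} (hr : MLRandom c) (hc : LeftCE c) (ha : LeftCE a) :
    ∃ e : ℚ, 0 < e ∧ LeftCE (c - e * a) := by
  obtain ⟨f, hf, mf, tf⟩ := hc
  obtain ⟨g, hg, mg, tg⟩ := ha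
  have lf := approx_le mf tf
  have lg := approx_le mg tg
  obtain ⟨K, hK⟩ := pow_unbounded_of_one_lt (a - g 0) (one_lt_two (α := ℝ))
  let e : ℕ → ℚ := fun i => (2⁻¹ : ℚ) ^ (i + K)
  have he : ∀ i, 0 < e i := fun i => by simp only [e]; positivity
  let t : ℕ → ℕ → ℚ × ℚ := fun i s => (max (rr f g (e i) s) (f s), rr f g (e i) (s + 1))
  have ht : Computable₂ t := by
    have ec : Computable (fun p : ℕ × ℕ => e p.1) :=
      chalf (Primrec.nat_add.to_comp.comp Computable.fst (Computable.const K))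
    exact (cmax (rr_comp hf hg ec Computable.snd) (hf.comp Computable.snd)).pair
      (rr_comp hf hg ec (Computable.succ.comp Computable.snd))
  obtain ⟨i, hi⟩ := hr t ht (by
    intro i
    refine (measure_iUnion_le _).trans ?_
    have hterm : ∀ s, volume (Set.Ioo (((t i s).1 : ℝ)) (((t i s).2 : ℝ))) =
        ENNReal.ofReal ((e i : ℝ) * (g (s + 1) - g s)) := by
      intro s
      rw [Real.volume_Ioo]
      congr 1
      simp only [t, rr_succ]
      push_cast
      ring
    simp only [hterm]
    apply ENNReal.tsum_le_of_sum_range_le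
    intro n
    rw [← ENNReal.ofReal_sum_of_nonneg, ← Finset.mul_sum, Finset.sum_range_sub (fun s => (g s : ℝ))]
    · have h1 : (e i : ℝ) * (g n - g 0) ≤ (2⁻¹ : ℝ) ^ i := by
        have h2 : (e i : ℝ) = (2⁻¹ : ℝ) ^ i * (2 ^ K)⁻¹ := by
          simp only [e]; push_cast; rw [pow_add]; simp
        have h3 : ((2 : ℝ) ^ K)⁻¹ * (g n - g 0) ≤ 1 := by
          rw [inv_mul_le_iff₀ (by positivity)]
          have := lg n
          linarith
        rw [h2, mul_assoc]
        exact mul_le_of_le_one_right (by positivity) h3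
      refine (ENNReal.ofReal_le_ofReal h1).trans ?_
      rw [ENNReal.ofReal_pow (by norm_num), ENNReal.ofReal_inv_of_pos (by norm_num)]
      simp
    · intro s _
      have h1 : (0 : ℝ) ≤ e i := by exact_mod_cast (he i).le
      have h2 : (g s : ℝ) ≤ g (s + 1) := by exact_mod_cast mg (Nat.le_succ s)
      exact mul_nonneg h1 (by linarith))
  have hrc : ∀ s, (rr f g (e i) s : ℝ) ≤ c := by
    intro s
    induction s with
    | zero => exact lf 0
    | succ s ih =>
      by_contra hcon
      push Not at hcon
      apply hi
      refine Set.mem_iUnion.2 ⟨s, ?_, hcon⟩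
      refine lt_of_le_of_ne ?_ (random_irr hr _).symm
      simp only [t]
      push_cast
      exact max_le ih (lf s)
  refine ⟨e i, he i, fun s => rr f g (e i) s - e i * g s, ?_, ?_, ?_⟩
  · exact csub (rr_comp hf hg (Computable.const _) Computable.id) (cmul (Computable.const _) hg)
  · apply monotone_nat_of_le_succ
    intro s
    rw [rr_succ]
    have := le_max_left (rr f g (e i) s) (f s)
    linarith
  · push_cast
    refine Tendsto.sub ?_ (tg.const_mul _)
    rw [← tendsto_add_atTop_iff_nat 1]
    refine tendsto_of_tendsto_of_tendsto_of_le_of_le tf tendsto_const_nhds ?_ (fun s => hrc _)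
    intro s
    have h1 : f s ≤ rr f g (e i) (s + 1) := by
      rw [rr_succ]
      have := le_max_right (rr f g (e i) s) (f s)
      have := mul_nonneg (he i).le (sub_nonneg.2 (mg (Nat.le_succ s)))
      simp only [Nat.succ_eq_add_one] at this
      linarith
    simp only
    exact_mod_cast h1

/-- running maximum -/
def mm (d : ℕ → ℚ) (n : ℕ) : ℚ :=
  Nat.rec (motive := fun _ => ℚ) (d 0) (fun s r => max r (d (s + 1))) n

theorem leftCE_of_lt {x : ℝ} {d : ℕ → ℚ} (hd : Computable d) (h : ∀ n, (d n : ℝ) ≤ x)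
    (td : Tendsto (fun n => (d n : ℝ)) atTop (nhds x)) : LeftCE x := by
  let m : ℕ → ℚ := mm d
  have ms : ∀ s, m (s + 1) = max (m s) (d (s + 1)) := fun s => rfl
  have hle : ∀ n, (m n : ℝ) ≤ x := by
    intro n
    induction n with
    | zero => exact h 0
    | succ n ih => rw [ms]; push_cast; exact max_le ih (h _)
  refine ⟨m, ?_, ?_, ?_⟩
  · refine Computable.nat_rec (f := fun n : ℕ => n) (g := fun _ => d 0)
      (h := fun x p => max p.2 (d (p.1 + 1))) Computable.id (Computable.const _) ?_
    exact cmax (Computable.snd.comp Computable.snd)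
      (hd.comp (Computable.succ.comp (Computable.fst.comp Computable.snd)))
  · apply monotone_nat_of_le_succ
    intro s
    rw [ms]
    exact le_max_left _ _
  · refine tendsto_of_tendsto_of_tendsto_of_le_of_le td tendsto_const_nhds ?_ hle
    intro s
    have : d s ≤ m s := by
      cases s with
      | zero => exact le_rfl
      | succ s => rw [ms]; exact le_max_right _ _
    simp only
    exact_mod_cast this

/-- number of intervals -/
def cnt (l u : ℕ → ℚ) (p q : ℚ) (s : ℕ) : ℕ :=
  Nat.rec (motive := fun _ => ℕ) 0
    (fun t c => c + bif (decide (l t ≤ p) && decide (q ≤ u t)) then 1 else 0) s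

theorem cnt_eq (l u : ℕ → ℚ) (p q : ℚ) (s : ℕ) :
    cnt l u p q s = ∑ t ∈ Finset.range s, if (l t ≤ p ∧ q ≤ u t) then 1 else 0 := by
  induction s with
  | zero => rfl
  | succ s ih =>
    rw [Finset.sum_range_succ, ← ih]
    simp only [cnt]
    congr 1
    by_cases h1 : l s ≤ p <;> by_cases h2 : q ≤ u s <;> simp [h1, h2]

theorem cnt_comp {A : Type*} [Primcodable A] {l u : ℕ → ℚ} (hl : Computable l) (hu : Computable u)
    {p q : A → ℚ} {s : A → ℕ} (hp : Computable p) (hq : Computable q) (hs : Computable s) :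
    Computable (fun x => cnt l u (p x) (q x) (s x)) := by
  refine Computable.nat_rec (f := s) (g := fun _ => 0)
    (h := fun x y => y.2 + bif (decide (l y.1 ≤ p x) && decide (q x ≤ u y.1)) then 1 else 0) hs (Computable.const _) ?_
  have p1 : Computable (fun y : A × ℕ × ℕ => y.2.1) := Computable.fst.comp Computable.snd
  have p2 : Computable (fun y : A × ℕ × ℕ => y.2.2) := Computable.snd.comp Computable.snd
  exact Primrec.nat_add.to_comp.comp p2 (Computable.cond
    (Primrec.and.to_comp.comp (cle (hl.comp p1) (hp.comp Computable.fst)) (cle (hq.comp Computable.fst) (hu.comp p1)))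
    (Computable.const 1) (Computable.const 0))

theorem solovay {x : ℝ} (hr : MLRandom x) {l u : ℕ → ℚ} (hl : Computable l) (hu : Computable u)
    (hlu : ∀ n, l n ≤ u n) (C : ℝ) (hC : ∀ n, ∑ t ∈ Finset.range n, ((u t : ℝ) - l t) ≤ C) :
    ∃ N, ∀ n ≥ N, x ∉ Set.Ioo (l n : ℝ) (u n) := by
  by_contra hcon
  push Not at hcon
  obtain ⟨K, hK⟩ := pow_unbounded_of_one_lt C (one_lt_two (α := ℝ))
  let P : ℕ → ℚ := fun n => Denumerable.ofNat ℚ n.unpair.1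
  let Q : ℕ → ℚ := fun n => Denumerable.ofNat ℚ n.unpair.2.unpair.1
  let S : ℕ → ℕ := fun n => n.unpair.2.unpair.2
  have hP : Computable P := (Computable.ofNat ℚ).comp (Computable.fst.comp Computable.unpair)
  have hQ : Computable Q := (Computable.ofNat ℚ).comp (Computable.fst.comp (Computable.unpair.comp (Computable.snd.comp Computable.unpair)))
  have hS : Computable S := (Computable.snd.comp (Computable.unpair.comp (Computable.snd.comp Computable.unpair)))
  let t : ℕ → ℕ → ℚ × ℚ := fun i n =>
    bif decide (2 ^ (i + K) ≤ cnt l u (P n) (Q n) (S n)) then (P n, Q n) else (0, 0)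
  have ht : Computable₂ t := by
    have lec : Computable₂ (fun a b : ℕ => decide (a ≤ b)) := Primrec.nat_le.decide.to_comp
    have pw : Computable (fun n : ℕ => 2 ^ n) := by
      have : Computable (fun n : ℕ => Nat.rec (motive := fun _ => ℕ) 1 (fun _ x => x * 2) n) :=
        Computable.nat_rec (f := fun n : ℕ => n) (g := fun _ => 1)
          (h := fun _ p => p.2 * 2) Computable.id (Computable.const _)
          (Primrec.nat_mul.to_comp.comp (Computable.snd.comp Computable.snd) (Computable.const _)).to₂
      refine this.of_eq (fun n => ?_)
      induction n with
      | zero => simp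
      | succ n ih => simp only at ih ⊢; rw [ih, pow_succ]
    have p' : Computable (fun y : ℕ × ℕ => P y.2) := hP.comp Computable.snd
    have q' : Computable (fun y : ℕ × ℕ => Q y.2) := hQ.comp Computable.snd
    exact Computable.cond (lec.comp (pw.comp (Primrec.nat_add.to_comp.comp Computable.fst (Computable.const K)))
      (cnt_comp hl hu p' q' (hS.comp Computable.snd))) (p'.pair q') (Computable.const (0, 0))
  let F : ℝ → ENNReal := fun y => ∑' n, (Set.Ioo (l n : ℝ) (u n)).indicator 1 y
  have hF : ∫⁻ y, F y ≤ 2 ^ K := by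
    simp only [F]
    rw [lintegral_tsum]
    · apply ENNReal.tsum_le_of_sum_range_le
      intro n
      simp only [lintegral_indicator_one measurableSet_Ioo, Real.volume_Ioo]
      rw [← ENNReal.ofReal_sum_of_nonneg]
      · refine (ENNReal.ofReal_le_ofReal ((hC n).trans hK.le)).trans ?_
        rw [ENNReal.ofReal_pow (by norm_num)]
        simp
      · intro s _
        have : (l s : ℝ) ≤ u s := by exact_mod_cast hlu s
        linarith
    · intro n
      exact (measurable_one.indicator measurableSet_Ioo).aemeasurable
  have hFm : Measurable F := Measurable.ennreal_tsum (fun n => measurable_one.indicator measurableSet_Ioo)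
  obtain ⟨i, hi⟩ := hr t ht (by
    intro i
    have hsub : testSet t i ⊆ {y | (2 : ENNReal) ^ (i + K) ≤ F y} := by
      apply Set.iUnion_subset
      intro n y hy
      simp only [t] at hy
      by_cases h : 2 ^ (i + K) ≤ cnt l u (P n) (Q n) (S n)
      · simp only [h, decide_true, cond_true] at hy
        rw [Set.mem_setOf_eq]
        calc (2 : ENNReal) ^ (i + K) = ((2 ^ (i + K) : ℕ) : ENNReal) := by push_cast; rfl
          _ ≤ (cnt l u (P n) (Q n) (S n) : ENNReal) := by exact_mod_cast h
          _ ≤ ∑ k ∈ Finset.range (S n), (Set.Ioo (l k : ℝ) (u k)).indicator 1 y := by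
            rw [cnt_eq]
            push_cast
            apply Finset.sum_le_sum
            intro k _
            split_ifs with hk
            · rw [Set.indicator_of_mem]
              · simp
              · have h1 : (l k : ℝ) ≤ P n := by exact_mod_cast hk.1
                have h2 : (Q n : ℝ) ≤ u k := by exact_mod_cast hk.2
                exact ⟨h1.trans_lt hy.1, hy.2.trans_le h2⟩
            · simp
          _ ≤ F y := ENNReal.sum_le_tsum _
      · simp only [h, decide_false, cond_false] at hy
        exact absurd (hy.1.trans hy.2) (lt_irrefl _)
    have hmark := (mul_meas_ge_le_lintegral (μ := volume) hFm ((2 : ENNReal) ^ (i + K))).trans hF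
    refine (measure_mono hsub).trans ?_
    have h2 : (2 : ENNReal) ^ (i + K) ≠ 0 := by simp
    have h3 : (2 : ENNReal) ^ (i + K) ≠ ⊤ := ENNReal.pow_ne_top (by simp)
    rw [mul_comm, ← ENNReal.le_div_iff_mul_le (Or.inl h2) (Or.inl h3)] at hmark
    refine hmark.trans ?_
    rw [ENNReal.div_le_iff h2 h3, pow_add, ← mul_assoc, ← mul_pow, ENNReal.inv_mul_cancel (by simp) (by simp)]
    all_goals simp)
  apply hi
  have hinf : {n | x ∈ Set.Ioo (l n : ℝ) (u n)}.Infinite := by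
    rw [Set.infinite_iff_exists_gt]
    intro a
    obtain ⟨n, hn, hx⟩ := hcon (a + 1)
    exact ⟨n, hx, hn⟩
  obtain ⟨T, hT, hcard⟩ := hinf.exists_subset_card_eq (2 ^ (i + K))
  have hev : ∀ᶠ y in nhds x, ∀ k ∈ T, y ∈ Set.Ioo (l k : ℝ) (u k) := by
    rw [Filter.eventually_all_finset]
    intro k hk
    exact Ioo_mem_nhds (hT hk).1 (hT hk).2
  obtain ⟨δ, hδ, hball⟩ := Metric.eventually_nhds_iff.1 hev
  obtain ⟨p, hp1, hp2⟩ := exists_rat_btwn (show x - δ < x by linarith)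
  obtain ⟨q, hq1, hq2⟩ := exists_rat_btwn (show x < x + δ by linarith)
  have hpb := @hball p (by rw [Real.dist_eq, abs_lt]; constructor <;> linarith)
  have hqb := @hball q (by rw [Real.dist_eq, abs_lt]; constructor <;> linarith)
  let en : ℚ → ℕ := @Encodable.encode ℚ (@Denumerable.toEncodable ℚ Rat.instDenumerable)
  let n := Nat.pair (en p) (Nat.pair (en q) (T.sup id + 1))
  have hPn : P n = p := by simp only [P, n, Nat.unpair_pair, en]; exact ofNat_enc p
  have hQn : Q n = q := by simp only [Q, n, Nat.unpair_pair, en]; exact ofNat_enc q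
  have hSn : S n = T.sup id + 1 := by simp only [S, n, Nat.unpair_pair]
  refine Set.mem_iUnion.2 ⟨n, ?_⟩
  have hcn : 2 ^ (i + K) ≤ cnt l u (P n) (Q n) (S n) := by
    rw [hPn, hQn, hSn, cnt_eq, ← hcard, Finset.sum_boole, Nat.cast_id]
    apply Finset.card_le_card
    intro k hk
    rw [Finset.mem_filter, Finset.mem_range]
    refine ⟨Nat.lt_succ_of_le (Finset.le_sup (f := id) hk), ?_, ?_⟩
    · have := (hpb k hk).1.le
      exact_mod_cast this
    · have := (hqb k hk).2.le
      exact_mod_cast this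
  have htn : t i n = (p, q) := by
    simp only [t, hcn, decide_true, cond_true]
    rw [hPn, hQn]
  rw [htn]
  exact ⟨hp2, hq1⟩

theorem rz_aux {x : ℝ} (hr : MLRandom x) {d : ℕ → ℚ} (hd : Computable d)
    (td : Tendsto (fun n => (d n : ℝ)) atTop (nhds x)) (N : ℕ)
    (hN : ∀ n ≥ N, x ∉ Set.Ioo ((min (d n) (d (n + 1)) : ℚ) : ℝ) ((max (d n) (d (n + 1)) : ℚ) : ℝ))
    (h0 : (d N : ℝ) < x) : LeftCE x := by
  have hall : ∀ n, (d (N + n) : ℝ) < x := by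
    intro n
    induction n with
    | zero => exact h0
    | succ n ih =>
      refine lt_of_le_of_ne ?_ (random_irr hr _).symm
      by_contra hcon
      push Not at hcon
      apply hN (N + n) (by omega)
      push_cast
      exact ⟨min_lt_of_left_lt ih, lt_max_of_lt_right hcon⟩
  refine leftCE_of_lt (d := fun n => d (N + n)) ?_ (fun n => (hall n).le) ?_
  · exact hd.comp (Primrec.nat_add.to_comp.comp (Computable.const N) Computable.id)
  · have := (tendsto_add_atTop_iff_nat N).2 td
    simpa only [add_comm] using this

theorem rz {a b : ℝ} (ha : LeftCE a) (hb : LeftCE b) (hr : MLRandom (a - b)) :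
    LeftCE (a - b) ∨ LeftCE (-(a - b)) := by
  obtain ⟨f, hf, mf, tf⟩ := ha
  obtain ⟨g, hg, mg, tg⟩ := hb
  have lf := approx_le mf tf
  have lg := approx_le mg tg
  let d : ℕ → ℚ := fun n => f n - g n
  have hd : Computable d := csub hf hg
  have hds : Computable (fun n => d (n + 1)) := hd.comp Computable.succ
  have td : Tendsto (fun n => (d n : ℝ)) atTop (nhds (a - b)) := by
    simp only [d]
    push_cast
    exact tf.sub tg
  obtain ⟨N, hN⟩ := solovay hr (cmin hd hds) (cmax hd hds) (fun n => min_le_max)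
    ((a - f 0) + (b - g 0)) (by
      intro n
      calc ∑ t ∈ Finset.range n, (((max (d t) (d (t + 1)) : ℚ) : ℝ) - ((min (d t) (d (t + 1)) : ℚ) : ℝ))
          ≤ ∑ t ∈ Finset.range n, (((f (t + 1) : ℝ) - f t) + (g (t + 1) - g t)) := by
            apply Finset.sum_le_sum
            intro t _
            have h1 : f t ≤ f (t + 1) := mf (Nat.le_succ t)
            have h2 : g t ≤ g (t + 1) := mg (Nat.le_succ t)
            have : max (d t) (d (t + 1)) - min (d t) (d (t + 1)) ≤ (f (t + 1) - f t) + (g (t + 1) - g t) := by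
              rw [max_sub_min_eq_abs, abs_le]
              simp only [d]
              constructor <;> linarith
            exact_mod_cast this
        _ ≤ _ := by
            rw [Finset.sum_add_distrib, Finset.sum_range_sub (fun s => (f s : ℝ)), Finset.sum_range_sub (fun s => (g s : ℝ))]
            have := lf n
            have := lg n
            linarith)
  rcases lt_or_gt_of_ne (random_irr hr (d N)) with h | h
  · right
    refine rz_aux (random_neg hr) (d := fun n => - d n) (cneg hd) ?_ N ?_ ?_
    · push_cast
      exact td.neg
    · intro n hn hx
      apply hN n hn
      rw [min_neg_neg, max_neg_neg] at hx
      push_cast at hx ⊢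
      constructor
      · linarith [hx.2]
      · linarith [hx.1]
    · push_cast
      linarith
  · left
    exact rz_aux hr hd td N hN h

/-- Let `α, β` be Martin-Löf random left-c.e. reals. If `D(α,β) = 1`, then `α - β` is
not Martin-Löf random. -/
theorem D_eq_one (a b : ℝ) (ha : LeftCE a) (har : MLRandom a)
    (hb : LeftCE b) (hbr : MLRandom b) (h : DD a b = 1) :
    ¬ MLRandom (a - b) := by
  intro hr
  unfold DD at h
  set S := {x : ℝ | ∃ q : ℚ, 0 < q ∧ x = (q : ℝ) ∧ LeftCE ((q : ℝ) * a - b)} with hS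
  have hne : S.Nonempty := by
    by_contra hcon
    rw [Set.not_nonempty_iff_eq_empty] at hcon
    rw [hcon, Real.sInf_empty] at h
    norm_num at h
  have hbdd : BddBelow S := ⟨0, by
    rintro x ⟨q, hq, rfl, -⟩
    exact_mod_cast hq.le⟩
  rcases rz ha hb hr with hc | hc
  · obtain ⟨e, he, hce⟩ := ks hr hc ha
    have h1 := leftCE_add hce (leftCE_smul ha (e - min e (1/2)) (sub_nonneg.2 (min_le_left _ _)))
    have hmem : (((1 - min e (1/2) : ℚ)) : ℝ) ∈ S := by
      refine ⟨_, ?_, rfl, ?_⟩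
      · have := min_le_right e (1/2)
        linarith
      · convert h1 using 1
        push_cast
        ring
    have h2 := csInf_le hbdd hmem
    rw [h] at h2
    have h3 : (1 : ℚ) ≤ 1 - min e (1/2) := by exact_mod_cast h2
    have : 0 < min e (1/2) := lt_min he (by norm_num)
    linarith
  · obtain ⟨e, he, hce⟩ := ks (random_neg hr) hc ha
    have he' : (0 : ℝ) < e := by exact_mod_cast he
    obtain ⟨x, ⟨q, hq, rfl, hq1⟩, hx⟩ := exists_lt_of_csInf_lt hne (show sInf S < 1 + e by rw [h]; linarith)
    have hx' : q < 1 + e := by exact_mod_cast hx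
    have hpos : 0 < 1 + e - q := by linarith
    have h1 := leftCE_smul (leftCE_add hce hq1) (1 + e - q)⁻¹ (inv_nonneg.2 hpos.le)
    refine not_random_of_both ha ?_ har
    convert h1 using 1
    have : ((1 + e - q : ℚ) : ℝ) ≠ 0 := by exact_mod_cast hpos.ne'
    push_cast at this ⊢
    field_simp
    ring
end

section
/- If α, β are Martin-Löf random left-c.e. reals, then D(α,β) · D(β,α) = 1. -/
open Filter MeasureTheory Set

namespace DMul

open Encodable

def cc (x : ℚ) : ℕ := Nat.pair (Encodable.encode x.num) x.den

def inS (k : ℕ) : Prop :=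
  (Nat.unpair k).2 ≠ 0 ∧ ∀ x < (Nat.unpair k).2 + 1,
    ¬ (((Nat.unpair k).1 + 1) / 2 % x = 0 ∧ (Nat.unpair k).2 % x = 0 ∧ x ≠ 1)

theorem enc_int_abs (z : ℤ) : (Encodable.encode z + 1) / 2 = z.natAbs := by
  rcases z with n | n
  · have : Encodable.encode (Int.ofNat n) = 2 * n := rfl
    rw [this]; simp; omega
  · have : Encodable.encode (Int.negSucc n) = 2 * n + 1 := rfl
    rw [this]; simp; omega

theorem inS_iff (k : ℕ) : inS k ↔ k ∈ Set.range cc := by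
  constructor
  · rintro ⟨h1, h2⟩
    let z : ℤ := Denumerable.ofNat ℤ (Nat.unpair k).1
    have hz : Encodable.encode z = (Nat.unpair k).1 := Denumerable.encode_ofNat _
    rw [← hz, enc_int_abs] at h2
    have hco : z.natAbs.Coprime (Nat.unpair k).2 := by
      by_contra hc
      refine h2 (Nat.gcd z.natAbs (Nat.unpair k).2) ?_ ⟨?_, ?_, hc⟩
      · exact Nat.lt_succ_of_le (Nat.gcd_le_right _ (Nat.pos_of_ne_zero h1))
      · exact Nat.mod_eq_zero_of_dvd (Nat.gcd_dvd_left _ _)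
      · exact Nat.mod_eq_zero_of_dvd (Nat.gcd_dvd_right _ _)
    refine ⟨⟨z, (Nat.unpair k).2, h1, hco⟩, ?_⟩
    simp only [cc, hz, Nat.pair_unpair]
  · rintro ⟨x, rfl⟩
    simp only [inS, cc, Nat.unpair_pair, enc_int_abs]
    refine ⟨x.den_nz, ?_⟩
    rintro y - ⟨h1, h2, h3⟩
    exact h3 (Nat.eq_one_of_dvd_coprimes x.reduced (Nat.dvd_of_mod_eq_zero h1)
      (Nat.dvd_of_mod_eq_zero h2))

theorem inS_primrec : PrimrecPred inS := by
  have hd : Primrec fun k : ℕ => (Nat.unpair k).2 := Primrec.snd.comp Primrec.unpair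
  have ha : Primrec fun k : ℕ => ((Nat.unpair k).1 + 1) / 2 :=
    Primrec.nat_div.comp (Primrec.succ.comp (Primrec.fst.comp Primrec.unpair)) (Primrec.const 2)
  have hR : PrimrecRel fun x k : ℕ =>
      ¬ (((Nat.unpair k).1 + 1) / 2 % x = 0 ∧ (Nat.unpair k).2 % x = 0 ∧ x ≠ 1) := by
    apply PrimrecRel.not
    apply PrimrecPred.and
    · exact Primrec.eq.comp (Primrec.nat_mod.comp (ha.comp Primrec.snd) Primrec.fst)
        (Primrec.const 0)
    apply PrimrecPred.and
    · exact Primrec.eq.comp (Primrec.nat_mod.comp (hd.comp Primrec.snd) Primrec.fst)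
        (Primrec.const 0)
    · exact (Primrec.eq.comp Primrec.fst (Primrec.const 1)).not
  apply PrimrecPred.and
  · exact (Primrec.eq.comp hd (Primrec.const 0)).not
  · exact hR.forall_lt.comp (Primrec.succ.comp hd) Primrec.id

def renc (x : ℚ) : ℕ := @Encodable.encode ℚ Primcodable.toEncodable x

theorem renc_comp : Computable renc := Computable.encode

theorem renc_inj : Function.Injective renc := fun _ _ h =>
  @Encodable.encode_injective ℚ Primcodable.toEncodable _ _ h

open Classical in
theorem enc_eq (x : ℚ) : renc x = Nat.count inS (cc x) := by
  have h : renc x = (List.range (cc x)).countP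
    (fun k => @decide (k ∈ Set.range (@Encodable.encode ℚ Rat.instEncodable))
      (Encodable.decidableRangeEncode ℚ k)) := rfl
  rw [h]
  rw [Nat.count]
  apply List.countP_congr
  intro k _
  simp only [decide_eq_true_eq]
  rw [inS_iff]
  rfl

open Classical in
theorem count_comp : Computable (fun k => Nat.count inS k) := by
  have h : Computable fun k : ℕ => decide (inS k) := by
    exact (inS_primrec.decide).to_comp
  have := Computable.nat_rec (f := fun k : ℕ => k) (g := fun _ => (0:ℕ))
    (h := fun _ p => cond (decide (inS p.1)) (p.2 + 1) p.2) Computable.id (Computable.const 0) (by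
      have h1 : Computable fun q : ℕ × ℕ × ℕ => q.2.1 := Computable.fst.comp Computable.snd
      have h2 : Computable fun q : ℕ × ℕ × ℕ => q.2.2 := Computable.snd.comp Computable.snd
      exact Computable.cond (h.comp h1) (Computable.succ.comp h2) h2)
  refine this.of_eq fun k => ?_
  induction k with
  | zero => simp
  | succ k ih =>
    rw [Nat.count_succ, ← ih]
    by_cases hk : inS k <;> simp [hk]

theorem comp_of_graph {α β : Type*} [Primcodable α] [Denumerable β] {f : α → β}
    {R : α → β → Bool} (hR : Computable₂ R) (h1 : ∀ a, R a (f a) = true)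
    (h2 : ∀ a b, R a b = true → b = f a) : Computable f := by
  have hp : Partrec₂ (fun (a : α) (n : ℕ) => (R a (Denumerable.ofNat β n) : Part Bool)) := by
    apply Computable.partrec
    exact hR.comp Computable.fst ((Computable.ofNat β).comp Computable.snd)
  have := (Partrec.rfind hp).map (((Computable.ofNat β).comp Computable.snd).to₂)
  refine this.of_eq_tot fun a => ?_
  simp only [Part.mem_map_iff]
  obtain ⟨n, hn, -⟩ := Nat.rfind_min' (p := fun n => R a (Denumerable.ofNat β n))
    (m := Encodable.encode (f a)) (by simpa using h1 a)
  refine ⟨n, hn, h2 a _ ?_⟩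
  have := Nat.rfind_spec hn
  simpa using this

theorem cc_inj : Function.Injective cc := by
  intro x y h
  have := Nat.pair_eq_pair.1 h
  exact Rat.ext (Encodable.encode_injective this.1) this.2

open Classical in
theorem cc_comp : Computable cc := by
  have hS : Computable fun k : ℕ => decide (inS k) := (inS_primrec.decide).to_comp
  have heq : Computable₂ (fun a b : ℕ => decide (a = b)) := (Primrec.eq.decide).to_comp
  refine comp_of_graph (R := fun x k => cond (decide (inS k))
    (decide (Nat.count inS k = renc x)) false) ?_ ?_ ?_
  · exact Computable.cond (hS.comp Computable.snd)
      (heq.comp (count_comp.comp Computable.snd) (renc_comp.comp Computable.fst))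
      (Computable.const false)
  · intro a
    have : inS (cc a) := (inS_iff _).2 ⟨a, rfl⟩
    simp [this, enc_eq]
  · intro a k
    by_cases hk : inS k
    · simp only [hk, decide_true, cond_true, decide_eq_true_eq]
      intro h
      rw [enc_eq] at h
      obtain ⟨y, rfl⟩ := (inS_iff _).1 hk
      rw [← enc_eq, ← enc_eq] at h
      rw [renc_inj h]
    · simp [hk]

def pP (x : ℚ) : ℕ := x.num.toNat
def pM (x : ℚ) : ℕ := (-x.num).toNat

theorem pP_eq (x : ℚ) : pP x = (1 - (Nat.unpair (cc x)).1 % 2) * ((Nat.unpair (cc x)).1 / 2) := by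
  simp only [cc, Nat.unpair_pair, pP]
  rcases h : x.num with n | n
  · have : Encodable.encode (Int.ofNat n) = 2 * n := rfl
    rw [this]; simp
  · have : Encodable.encode (Int.negSucc n) = 2 * n + 1 := rfl
    rw [this]
    have : (2 * n + 1) % 2 = 1 := by omega
    simp [this]

theorem pM_eq (x : ℚ) : pM x = ((Nat.unpair (cc x)).1 % 2) * ((Nat.unpair (cc x)).1 / 2 + 1) := by
  simp only [cc, Nat.unpair_pair, pM]
  rcases h : x.num with n | n
  · have : Encodable.encode (Int.ofNat n) = 2 * n := rfl
    rw [this]; simp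
  · have : Encodable.encode (Int.negSucc n) = 2 * n + 1 := rfl
    rw [this]
    have h1 : (2 * n + 1) % 2 = 1 := by omega
    have h2 : (2 * n + 1) / 2 = n := by omega
    simp [h1, h2]

theorem nadd {α : Type*} [Primcodable α] {f g : α → ℕ} (hf : Computable f) (hg : Computable g) :
    Computable fun a => f a + g a := (Primrec.nat_add.to_comp).comp hf hg
theorem nmul {α : Type*} [Primcodable α] {f g : α → ℕ} (hf : Computable f) (hg : Computable g) :
    Computable fun a => f a * g a := (Primrec.nat_mul.to_comp).comp hf hg

theorem den_comp : Computable Rat.den := by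
  have h : Primrec fun k : ℕ => (Nat.unpair k).2 := Primrec.snd.comp Primrec.unpair
  exact (h.to_comp.comp cc_comp).of_eq fun x => by simp [cc]

theorem pP_comp : Computable pP := by
  have he : Primrec fun k : ℕ => (Nat.unpair k).1 := Primrec.fst.comp Primrec.unpair
  have h : Primrec fun k : ℕ => (1 - (Nat.unpair k).1 % 2) * ((Nat.unpair k).1 / 2) :=
    Primrec.nat_mul.comp (Primrec.nat_sub.comp (Primrec.const 1)
      (Primrec.nat_mod.comp he (Primrec.const 2))) (Primrec.nat_div.comp he (Primrec.const 2))
  exact (h.to_comp.comp cc_comp).of_eq fun x => (pP_eq x).symm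

theorem pM_comp : Computable pM := by
  have he : Primrec fun k : ℕ => (Nat.unpair k).1 := Primrec.fst.comp Primrec.unpair
  have h : Primrec fun k : ℕ => ((Nat.unpair k).1 % 2) * ((Nat.unpair k).1 / 2 + 1) :=
    Primrec.nat_mul.comp (Primrec.nat_mod.comp he (Primrec.const 2))
      (Primrec.succ.comp (Primrec.nat_div.comp he (Primrec.const 2)))
  exact (h.to_comp.comp cc_comp).of_eq fun x => (pM_eq x).symm

theorem rep (x : ℚ) : x = ((pP x : ℚ) - pM x) / x.den := by
  have h : (x.num : ℤ) = (pP x : ℤ) - pM x := by simp only [pP, pM]; omega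
  have h' : (x.num : ℚ) = (pP x : ℚ) - pM x := by exact_mod_cast congrArg (Int.cast : ℤ → ℚ) h
  rw [← h', Rat.num_div_den]

theorem rep_pos (x : ℚ) : (0 : ℚ) < x.den := by exact_mod_cast x.den_pos

theorem neq {α : Type*} [Primcodable α] {f g : α → ℕ} (hf : Computable f) (hg : Computable g) :
    Computable fun a => decide (f a = g a) :=
  Computable₂.comp (f := fun a b : ℕ => decide (a = b)) ((Primrec.eq.decide).to_comp) hf hg
theorem nle {α : Type*} [Primcodable α] {f g : α → ℕ} (hf : Computable f) (hg : Computable g) :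
    Computable fun a => decide (f a ≤ g a) :=
  Computable₂.comp (f := fun a b : ℕ => decide (a ≤ b)) ((Primrec.nat_le.decide).to_comp) hf hg

theorem mkq {α : Type*} [Primcodable α] {p m d : α → ℕ} {f : α → ℚ} (hp : Computable p)
    (hm : Computable m) (hd : Computable d) (hd0 : ∀ a, d a ≠ 0)
    (hf : ∀ a, f a = ((p a : ℚ) - m a) / d a) : Computable f := by
  have key : ∀ a (z : ℚ), (pP z * d a + m a * z.den = p a * z.den + pM z * d a) ↔ z = f a := by
    intro a z
    have h1 := rep_pos z
    have h2 : (0 : ℚ) < d a := by exact_mod_cast Nat.pos_of_ne_zero (hd0 a)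
    rw [hf a]
    conv_rhs => rw [rep z]
    rw [div_eq_div_iff h1.ne' h2.ne', ← @Nat.cast_inj ℚ]
    push_cast
    constructor <;> intro h <;> linarith
  refine comp_of_graph (R := fun a z =>
    decide (pP z * d a + m a * z.den = p a * z.den + pM z * d a)) ?_ ?_ ?_
  · have hs : Computable (fun q : α × ℚ => q.2) := Computable.snd
    have hfs : Computable (fun q : α × ℚ => q.1) := Computable.fst
    exact neq (nadd (nmul (pP_comp.comp hs) (hd.comp hfs)) (nmul (hm.comp hfs) (den_comp.comp hs)))
      (nadd (nmul (hp.comp hfs) (den_comp.comp hs)) (nmul (pM_comp.comp hs) (hd.comp hfs)))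
  · intro a; simpa using (key a (f a)).2 rfl
  · intro a z hz; exact (key a z).1 (by simpa using hz)

section ops
variable {α : Type*} [Primcodable α] {f g : α → ℚ}

theorem qneg (hf : Computable f) : Computable fun a => - f a := by
  refine mkq (pM_comp.comp hf) (pP_comp.comp hf) (den_comp.comp hf) (fun a => (f a).den_nz) ?_
  intro a
  conv_lhs => rw [rep (f a)]
  ring

theorem qadd (hf : Computable f) (hg : Computable g) : Computable fun a => f a + g a := by
  refine mkq
    (nadd (nmul (pP_comp.comp hf) (den_comp.comp hg)) (nmul (pP_comp.comp hg) (den_comp.comp hf)))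
    (nadd (nmul (pM_comp.comp hf) (den_comp.comp hg)) (nmul (pM_comp.comp hg) (den_comp.comp hf)))
    (nmul (den_comp.comp hf) (den_comp.comp hg))
    (fun a => Nat.mul_ne_zero (f a).den_nz (g a).den_nz) ?_
  intro a
  conv_lhs => rw [rep (f a), rep (g a)]
  have h1 := (rep_pos (f a)).ne'
  have h2 := (rep_pos (g a)).ne'
  push_cast
  field_simp
  ring

theorem qmul (hf : Computable f) (hg : Computable g) : Computable fun a => f a * g a := by
  refine mkq
    (nadd (nmul (pP_comp.comp hf) (pP_comp.comp hg)) (nmul (pM_comp.comp hf) (pM_comp.comp hg)))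
    (nadd (nmul (pP_comp.comp hf) (pM_comp.comp hg)) (nmul (pM_comp.comp hf) (pP_comp.comp hg)))
    (nmul (den_comp.comp hf) (den_comp.comp hg))
    (fun a => Nat.mul_ne_zero (f a).den_nz (g a).den_nz) ?_
  intro a
  conv_lhs => rw [rep (f a), rep (g a)]
  have h1 := (rep_pos (f a)).ne'
  have h2 := (rep_pos (g a)).ne'
  push_cast
  field_simp
  ring

theorem qsub (hf : Computable f) (hg : Computable g) : Computable fun a => f a - g a :=
  (qadd hf (qneg hg)).of_eq fun a => by ring

theorem qle (hf : Computable f) (hg : Computable g) : Computable fun a => decide (f a ≤ g a) := by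
  refine (nle (nadd (nmul (pP_comp.comp hf) (den_comp.comp hg))
      (nmul (pM_comp.comp hg) (den_comp.comp hf)))
    (nadd (nmul (pP_comp.comp hg) (den_comp.comp hf))
      (nmul (pM_comp.comp hf) (den_comp.comp hg)))).of_eq fun a => ?_
  apply decide_eq_decide.2
  conv_rhs => rw [rep (f a), rep (g a)]
  rw [div_le_div_iff₀ (rep_pos _) (rep_pos _), ← @Nat.cast_le ℚ]
  push_cast
  constructor <;> intro h <;> linarith

theorem qmax (hf : Computable f) (hg : Computable g) : Computable fun a => max (f a) (g a) := by
  refine (Computable.cond (qle hf hg) hg hf).of_eq fun a => ?_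
  by_cases h : f a ≤ g a
  · simp [h]
  · simp [h, le_of_not_ge h]

theorem qmin (hf : Computable f) (hg : Computable g) : Computable fun a => min (f a) (g a) := by
  refine (Computable.cond (qle hf hg) hf hg).of_eq fun a => ?_
  by_cases h : f a ≤ g a
  · simp [h]
  · simp [h, le_of_not_ge h]

theorem qpow (c : ℚ) {n : α → ℕ} (hn : Computable n) : Computable fun a => c ^ n a := by
  refine (Computable.nat_rec (g := fun _ => (1:ℚ)) (h := fun _ p => p.2 * c) hn
    (Computable.const 1) ?_).of_eq ?_
  · exact qmul (f := fun q : α × ℕ × ℚ => q.2.2) (Computable.snd.comp Computable.snd)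
      (Computable.const c)
  · intro a
    induction n a with
    | zero => simp
    | succ k ih => simp [pow_succ, ih]

end ops

theorem half_le {x : ℚ} {i : ℕ} (h : x ≤ (1/2)^i) : ENNReal.ofReal (x : ℝ) ≤ 2⁻¹ ^ i := by
  have h' : (x : ℝ) ≤ (1/2 : ℝ)^i := by
    have : (x : ℝ) ≤ (((1/2)^i : ℚ) : ℝ) := by exact_mod_cast h
    simpa using this
  refine (ENNReal.ofReal_le_ofReal h').trans (le_of_eq ?_)
  rw [ENNReal.ofReal_pow (by norm_num)]
  congr 1
  rw [one_div, ENNReal.ofReal_inv_of_pos (by norm_num)]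
  simp

theorem leftCE_of_below {z : ℕ → ℚ} (hz : Computable z) {x : ℝ}
    (ht : Tendsto (fun n => (z n : ℝ)) atTop (nhds x)) (N : ℕ)
    (h : ∀ n, N ≤ n → (z n : ℝ) ≤ x) : LeftCE x := by
  obtain ⟨m, hm0, hs, hm⟩ : ∃ m : ℕ → ℚ, m 0 = z N ∧
      (∀ n, m (n + 1) = max (m n) (z (N + (n + 1)))) ∧ Computable m := by
    refine ⟨fun n => Nat.rec (z N) (fun k acc => max acc (z (N + (k + 1)))) n, rfl,
      fun _ => rfl, ?_⟩
    refine Computable.nat_rec (f := fun n : ℕ => n) (g := fun _ => z N)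
      (h := fun _ p => max p.2 (z (N + (p.1 + 1)))) Computable.id (Computable.const _) ?_
    have h1 : Computable fun q : ℕ × ℕ × ℚ => q.2.1 := Computable.fst.comp Computable.snd
    have h2 : Computable fun q : ℕ × ℕ × ℚ => q.2.2 := Computable.snd.comp Computable.snd
    exact qmax h2 (hz.comp (nadd (Computable.const N) (Computable.succ.comp h1)))
  have hlow : ∀ n, z (N + n) ≤ m n := by
    intro n
    cases n with
    | zero => exact hm0.ge
    | succ n => rw [hs]; exact le_max_right _ _
  have hup : ∀ n, (m n : ℝ) ≤ x := by
    intro n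
    induction n with
    | zero => rw [hm0]; exact h N le_rfl
    | succ n ih =>
      rw [hs, Rat.cast_max]
      exact max_le ih (h _ (by omega))
  refine ⟨m, hm, monotone_nat_of_le_succ fun n => by rw [hs]; exact le_max_left _ _, ?_⟩
  have ht' : Tendsto (fun n => (z (N + n) : ℝ)) atTop (nhds x) := by
    have := (tendsto_add_atTop_iff_nat (f := fun n => (z n : ℝ)) N).2 ht
    simpa only [add_comm N] using this
  exact tendsto_of_tendsto_of_tendsto_of_le_of_le ht' tendsto_const_nhds
    (fun n => by have := hlow n; simpa using this) hup

theorem above_of_not_leftCE {z : ℕ → ℚ} (hz : Computable z) {x : ℝ}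
    (ht : Tendsto (fun n => (z n : ℝ)) atTop (nhds x)) (h : ¬ LeftCE x) (N : ℕ) :
    ∃ n, N ≤ n ∧ x < z n := by
  by_contra! hc
  exact h (leftCE_of_below hz ht N hc)

theorem LeftCE.add' {x y : ℝ} (hx : LeftCE x) (hy : LeftCE y) : LeftCE (x + y) := by
  obtain ⟨f, hf, mf, tf⟩ := hx
  obtain ⟨g, hg, mg, tg⟩ := hy
  refine ⟨fun n => f n + g n, qadd hf hg, mf.add mg, ?_⟩
  simpa using tf.add tg

theorem LeftCE.smul' {x : ℝ} (hx : LeftCE x) {q : ℚ} (hq : 0 ≤ q) : LeftCE ((q : ℝ) * x) := by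
  obtain ⟨f, hf, mf, tf⟩ := hx
  refine ⟨fun n => q * f n, qmul (Computable.const q) hf, mf.const_mul hq, ?_⟩
  simpa using tf.const_mul (q : ℝ)

theorem mono_le {f : ℕ → ℚ} (mf : Monotone f) {x : ℝ}
    (tf : Tendsto (fun n => (f n : ℝ)) atTop (nhds x)) (n : ℕ) : (f n : ℝ) ≤ x :=
  Monotone.ge_of_tendsto (f := fun n => (f n : ℝ)) (fun _ _ h => Rat.cast_le.2 (mf h)) tf n

theorem not_random_of_both {x : ℝ} (h1 : LeftCE x) (h2 : LeftCE (-x)) : ¬ MLRandom x := by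
  obtain ⟨f, hf, mf, tf⟩ := h1
  obtain ⟨g, hg, mg, tg⟩ := h2
  intro hr
  have lf := mono_le mf tf
  have lg := mono_le mg tg
  -- interval at stage n is (f n - δ, - g n + δ)
  let δ : ℕ → ℚ := fun i => (1/4) * (1/2) ^ i
  have hδ : ∀ i, 0 < δ i := fun i => by positivity
  have cδ : Computable δ := qmul (Computable.const _) (qpow _ Computable.id)
  let t : ℕ → ℕ → ℚ × ℚ := fun i n =>
    cond (decide (- g n - f n ≤ 2 * δ i)) (f n - δ i, - g n + δ i) (0, 0)
  have ct : Computable₂ t := by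
    have c1 : Computable fun q : ℕ × ℕ => δ q.1 := cδ.comp Computable.fst
    have c2 : Computable fun q : ℕ × ℕ => f q.2 := hf.comp Computable.snd
    have c3 : Computable fun q : ℕ × ℕ => g q.2 := hg.comp Computable.snd
    exact Computable.cond (qle (qsub (qneg c3) c2) (qmul (Computable.const 2) c1))
      ((qsub c2 c1).pair (qadd (qneg c3) c1)) (Computable.const _)
  obtain ⟨i, hi⟩ := hr t ct (by
    intro i
    by_cases hex : ∃ n, - g n - f n ≤ 2 * δ i
    · classical
      let n0 := Nat.find hex
      have hn0 : - g n0 - f n0 ≤ 2 * δ i := Nat.find_spec hex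
      have hsub : testSet t i ⊆ Set.Ioo ((f n0 - δ i : ℚ) : ℝ) ((- g n0 + δ i : ℚ) : ℝ) := by
        intro y hy
        simp only [testSet, Set.mem_iUnion] at hy
        obtain ⟨n, hn⟩ := hy
        by_cases hc : - g n - f n ≤ 2 * δ i
        · have hnn : n0 ≤ n := Nat.find_min' hex hc
          simp only [t, hc, decide_true, cond_true, Set.mem_Ioo] at hn
          have e1 : ((f n0 - δ i : ℚ) : ℝ) ≤ ((f n - δ i : ℚ) : ℝ) := by
            have := mf hnn
            exact_mod_cast (by linarith : f n0 - δ i ≤ f n - δ i)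
          have e2 : ((- g n + δ i : ℚ) : ℝ) ≤ ((- g n0 + δ i : ℚ) : ℝ) := by
            have := mg hnn
            exact_mod_cast (by linarith : - g n + δ i ≤ - g n0 + δ i)
          exact ⟨lt_of_le_of_lt e1 hn.1, lt_of_lt_of_le hn.2 e2⟩
        · simp only [t, hc, decide_false, cond_false, Set.mem_Ioo] at hn
          linarith [hn.1, hn.2]
      refine (measure_mono hsub).trans ?_
      rw [Real.volume_Ioo, ← Rat.cast_sub]
      have hle : ((- g n0 + δ i - (f n0 - δ i) : ℚ)) ≤ (1/2)^i := by
        have : 4 * δ i = (1/2)^i := by simp only [δ]; ring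
        linarith
      exact half_le hle
    · have : testSet t i = ∅ := by
        push Not at hex
        simp only [testSet, Set.iUnion_eq_empty]
        intro n
        have : ¬ (- g n - f n ≤ 2 * δ i) := not_le.2 (hex n)
        simp only [t, this, decide_false, cond_false, Set.Ioo_self]
      rw [this]; simp)
  apply hi
  have hlim : Tendsto (fun n => (-(g n : ℝ) - f n)) atTop (nhds 0) := by
    simpa using tg.neg.sub tf
  obtain ⟨n, hn⟩ := (hlim.eventually (gt_mem_nhds (show (0:ℝ) < 2 * δ i by
    have : (0:ℝ) < δ i := by exact_mod_cast hδ i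
    linarith))).exists
  have hn' : - g n - f n ≤ 2 * δ i := by exact_mod_cast hn.le
  simp only [testSet, Set.mem_iUnion]
  refine ⟨n, ?_⟩
  simp only [t, hn', decide_true, cond_true, Set.mem_Ioo]
  have := lf n
  have := lg n
  have : (0:ℝ) < δ i := by exact_mod_cast hδ i
  push_cast
  constructor <;> linarith

theorem random_lt {a : ℝ} (har : MLRandom a) {A : ℕ → ℚ} (mA : Monotone A)
    (tA : Tendsto (fun n => (A n : ℝ)) atTop (nhds a)) (n : ℕ) : (A n : ℝ) < a := by
  refine lt_of_le_of_ne (mono_le mA tA n) fun h => ?_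
  refine not_random_of_both (x := a) ⟨fun _ => A n, Computable.const _, monotone_const, ?_⟩
    ⟨fun _ => - A n, Computable.const _, monotone_const, ?_⟩ har
  · rw [← h]; exact tendsto_const_nhds
  · rw [← h]; push_cast; exact tendsto_const_nhds

/-- queue with service capacity `D` and arrivals `v`. -/
def Q (D v : ℕ → ℚ) : ℕ → ℚ
  | 0 => 0
  | n + 1 => max (Q D v n - D n) 0 + v n

def out (D v : ℕ → ℚ) (n : ℕ) : ℚ := min (Q D v n) (D n)

theorem Q_nonneg {D v : ℕ → ℚ} (hv : ∀ n, 0 ≤ v n) (n : ℕ) : 0 ≤ Q D v n := by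
  cases n with
  | zero => exact le_rfl
  | succ n => exact add_nonneg (le_max_right _ _) (hv n)

theorem out_nonneg {D v : ℕ → ℚ} (hD : ∀ n, 0 ≤ D n) (hv : ∀ n, 0 ≤ v n) (n : ℕ) :
    0 ≤ out D v n := le_min (Q_nonneg hv n) (hD n)

theorem out_sum (D v : ℕ → ℚ) (N : ℕ) :
    ∑ k ∈ Finset.range N, out D v k + Q D v N = ∑ k ∈ Finset.range N, v k := by
  induction N with
  | zero => simp [Q]
  | succ N ih =>
    rw [Finset.sum_range_succ, Finset.sum_range_succ, ← ih, Q, out]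
    rcases le_total (Q D v N) (D N) with h | h
    · rw [min_eq_left h, max_eq_right (by linarith)]; ring
    · rw [min_eq_right h, max_eq_left (by linarith)]; ring

theorem out_sum_le {D v : ℕ → ℚ} (hv : ∀ n, 0 ≤ v n) (N : ℕ) :
    ∑ k ∈ Finset.range N, out D v k ≤ ∑ k ∈ Finset.range N, v k := by
  have := out_sum D v N
  have := Q_nonneg (D := D) hv N
  linarith

/-- increments -/
def dl (A : ℕ → ℚ) (n : ℕ) : ℚ := A (n + 1) - A n

theorem dl_nonneg {A : ℕ → ℚ} (mA : Monotone A) (n : ℕ) : 0 ≤ dl A n :=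
  sub_nonneg.2 (mA (Nat.le_succ n))

theorem queue_mem {A v C : ℕ → ℚ} (hv : ∀ n, 0 ≤ v n) {a c : ℝ} {t : ℕ}
    (hC : ∀ n, t ≤ n → dl C n ≤ v n) (tC : Tendsto (fun n => (C n : ℝ)) atTop (nhds c))
    (h : a - A t < c - C t) : ∃ N0, ∀ N, N0 ≤ N → a < A N + Q (dl A) v N := by
  have key : ∀ N, t ≤ N → A t + (C N - C t) ≤ A N + Q (dl A) v N := by
    intro N hN
    induction N, hN using Nat.le_induction with
    | base => have := Q_nonneg (D := dl A) hv t; linarith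
    | succ N hN ih =>
      rw [Q]
      have h1 := hC N hN
      have h2 := le_max_left (Q (dl A) v N - dl A N) 0
      simp only [dl] at *
      linarith
  have ht : ∀ᶠ N in atTop, a - A t + C t < C N := tC.eventually (lt_mem_nhds (by linarith))
  obtain ⟨N0, hN0⟩ := eventually_atTop.1 ht
  refine ⟨max N0 t, fun N hN => ?_⟩
  have h1 := hN0 N (le_trans (le_max_left _ _) hN)
  have h2 : ((A t + (C N - C t) : ℚ) : ℝ) ≤ ((A N + Q (dl A) v N : ℚ) : ℝ) := by
    exact_mod_cast key N (le_trans (le_max_right _ _) hN)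
  push_cast at h2
  linarith

theorem queue_measure {A : ℕ → ℚ} (mA : Monotone A) {v : ℕ → ℚ} (hv : ∀ n, 0 ≤ v n)
    {r : ENNReal} (hr : ∀ N, ENNReal.ofReal ((∑ k ∈ Finset.range N, v k : ℚ) : ℝ) ≤ r) :
    volume (⋃ n, Set.Ioo (A n : ℝ) ((A n + Q (dl A) v n : ℚ) : ℝ)) ≤ r := by
  rw [measure_iUnion_eq_iSup_accumulate]
  refine iSup_le fun N => le_trans ?_ (hr N)
  induction N with
  | zero => simp [Set.accumulate_def, Q]
  | succ N ih =>
    rw [Set.accumulate_succ]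
    set M : ℚ := max (A N + Q (dl A) v N) (A (N + 1)) with hM
    have hend : A (N + 1) + Q (dl A) v (N + 1) = M + v N := by
      rw [Q, hM, ← add_assoc, ← max_add_add_left]
      simp only [dl]
      congr 2 <;> ring
    have hsub : Set.accumulate (fun n => Set.Ioo (A n : ℝ) ((A n + Q (dl A) v n : ℚ) : ℝ)) N ∪
        Set.Ioo (A (N + 1) : ℝ) ((A (N + 1) + Q (dl A) v (N + 1) : ℚ) : ℝ) ⊆
        Set.accumulate (fun n => Set.Ioo (A n : ℝ) ((A n + Q (dl A) v n : ℚ) : ℝ)) N ∪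
        Set.Ico (M : ℝ) ((M + v N : ℚ) : ℝ) := by
      rintro x (hx | hx)
      · exact Or.inl hx
      · rw [hend] at hx
        by_cases hxM : (M : ℝ) ≤ x
        · exact Or.inr ⟨hxM, hx.2⟩
        · left
          refine Set.subset_accumulate (x := N) ?_
          have h1 : (A N : ℝ) ≤ A (N + 1) := by exact_mod_cast mA (Nat.le_succ N)
          refine ⟨lt_of_le_of_lt h1 hx.1, ?_⟩
          push Not at hxM
          rw [hM, Rat.cast_max, lt_max_iff] at hxM
          rcases hxM with h | h
          · exact h
          · exact absurd hx.1 (not_lt.2 h.le)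
    refine (measure_mono hsub).trans ((measure_union_le _ _).trans ?_)
    have p1 : (0:ℝ) ≤ ((∑ k ∈ Finset.range N, v k : ℚ) : ℝ) :=
      Rat.cast_nonneg.2 (Finset.sum_nonneg fun k _ => hv k)
    have p2 : (0:ℝ) ≤ (v N : ℝ) := Rat.cast_nonneg.2 (hv N)
    have p3 : ((∑ k ∈ Finset.range (N + 1), v k : ℚ) : ℝ) =
        ((∑ k ∈ Finset.range N, v k : ℚ) : ℝ) + (v N : ℝ) := by
      rw [Finset.sum_range_succ]; exact Rat.cast_add _ _
    rw [p3, ENNReal.ofReal_add p1 p2]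
    refine add_le_add ih ?_
    rw [Real.volume_Ico]
    push_cast
    simp

theorem queue_test {a : ℝ} {A : ℕ → ℚ} (cA : Computable A) (mA : Monotone A)
    (tA : Tendsto (fun n => (A n : ℝ)) atTop (nhds a)) {v : ℕ → ℕ → ℚ}
    (hv : ∀ i n, 0 ≤ v i n) (hc : Computable₂ fun i n => Q (dl A) (v i) n)
    (hs : ∀ i N, ∑ k ∈ Finset.range N, v i k ≤ (1/2) ^ i)
    (hm : ∀ i, ∃ N, a < A N + Q (dl A) (v i) N) : ¬ MLRandom a := by
  intro har
  have hlt := random_lt har mA tA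
  obtain ⟨i, hi⟩ := har (fun i n => (A n, A n + Q (dl A) (v i) n)) (by
    have c2 : Computable fun q : ℕ × ℕ => A q.2 := cA.comp Computable.snd
    exact c2.pair (qadd c2 hc)) (by
    intro i
    refine queue_measure mA (hv i) fun N => ?_
    exact half_le (hs i N))
  apply hi
  obtain ⟨N, hN⟩ := hm i
  simp only [testSet, Set.mem_iUnion]
  refine ⟨N, hlt N, ?_⟩
  push_cast
  exact hN


theorem cdl {A : ℕ → ℚ} (cA : Computable A) : Computable (dl A) :=
  qsub (cA.comp Computable.succ) cA

theorem kucera_slaman {a b : ℝ} (ha : LeftCE a) (har : MLRandom a) (hb : LeftCE b) :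
    ∃ q : ℚ, 0 < q ∧ LeftCE ((q : ℝ) * a - b) := by
  by_contra! hcon
  obtain ⟨A, cA, mA, tA⟩ := ha
  obtain ⟨B, cB, mB, tB⟩ := hb
  obtain ⟨K0, hK0⟩ := exists_nat_ge (b - B 0)
  let K : ℚ := K0 + 1
  have hK : 0 < K := by positivity
  have hKb : b - B 0 ≤ (K : ℝ) := by
    simp only [K]; push_cast; linarith
  let s : ℕ → ℚ := fun i => (1 / K) * (1/2) ^ i
  have hs : ∀ i, 0 < s i := fun i => by positivity
  have cs : Computable s := qmul (Computable.const _) (qpow _ Computable.id)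
  let v : ℕ → ℕ → ℚ := fun i n => s i * dl B n
  have hv : ∀ i n, 0 ≤ v i n := fun i n => mul_nonneg (hs i).le (dl_nonneg mB n)
  have lb := mono_le mB tB
  refine queue_test cA mA tA hv ?_ ?_ ?_ har
  · have e : (fun p : ℕ × ℕ => Q (dl A) (v p.1) p.2) = fun p : ℕ × ℕ =>
        (Nat.rec (0 : ℚ) (fun k acc => max (acc - dl A k) 0 + v p.1 k) p.2 : ℚ) := by
      funext p
      obtain ⟨i, n⟩ := p
      simp only
      induction n with
      | zero => rfl
      | succ n ih => simp only [Q, ih]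
    show Computable fun p : ℕ × ℕ => Q (dl A) (v p.1) p.2
    rw [e]
    refine Computable.nat_rec (f := fun p : ℕ × ℕ => p.2) (g := fun _ => (0 : ℚ))
      (h := fun p q => max (q.2 - dl A q.1) 0 + v p.1 q.1) Computable.snd (Computable.const _) ?_
    have h0 : Computable fun q : (ℕ × ℕ) × ℕ × ℚ => q.1.1 := Computable.fst.comp Computable.fst
    have h1 : Computable fun q : (ℕ × ℕ) × ℕ × ℚ => q.2.1 := Computable.fst.comp Computable.snd
    have h2 : Computable fun q : (ℕ × ℕ) × ℕ × ℚ => q.2.2 := Computable.snd.comp Computable.snd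
    exact qadd (qmax (qsub h2 ((cdl cA).comp h1)) (Computable.const 0))
      (qmul (cs.comp h0) ((cdl cB).comp h1))
  · intro i N
    have e : ∑ k ∈ Finset.range N, v i k = s i * (B N - B 0) := by
      simp only [v, ← Finset.mul_sum, dl, Finset.sum_range_sub]
    rw [e]
    have h1 : B N - B 0 ≤ K := by
      have h2 := lb N
      have : ((B N - B 0 : ℚ) : ℝ) ≤ (K : ℝ) := by push_cast; linarith
      exact_mod_cast this
    calc s i * (B N - B 0) ≤ s i * K := mul_le_mul_of_nonneg_left h1 (hs i).le
      _ = (1/2)^i := by simp only [s]; field_simp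
  · intro i
    have hq := hcon (1 / s i) (one_div_pos.2 (hs i))
    have tz : Tendsto (fun n => (((1 / s i) * A n - B n : ℚ) : ℝ)) atTop
        (nhds (((1 / s i : ℚ) : ℝ) * a - b)) := by
      have := (tA.const_mul ((1 / s i : ℚ) : ℝ)).sub tB
      simpa using this
    obtain ⟨t, -, ht⟩ := above_of_not_leftCE
      (qsub (qmul (Computable.const (1 / s i)) cA) cB) tz hq 0
    have hsr : (0 : ℝ) < (s i : ℝ) := by exact_mod_cast hs i
    have tC : Tendsto (fun n => ((s i * B n : ℚ) : ℝ)) atTop (nhds ((s i : ℝ) * b)) := by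
      simpa using tB.const_mul (s i : ℝ)
    obtain ⟨N0, hN0⟩ := queue_mem (A := A) (v := v i) (C := fun n => s i * B n) (hv i) (a := a)
      (c := (s i : ℝ) * b) (t := t)
      (fun n _ => by simp only [dl, v]; rw [mul_sub]) tC (by
        push_cast at ht ⊢
        have h3 := mul_lt_mul_of_pos_left ht hsr
        have e1 : (s i : ℝ) * (1 / (s i : ℝ) * a - b) = a - s i * b := by field_simp
        have e2 : (s i : ℝ) * (1 / (s i : ℝ) * A t - B t) = A t - s i * B t := by field_simp
        rw [e1, e2] at h3
        linarith)
    exact ⟨N0, hN0 N0 le_rfl⟩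

def U (A B : ℕ → ℚ) (c : ℚ) : ℕ → ℕ → ℚ
  | 0 => dl A
  | n + 1 => out (dl A) (out (dl B) (fun k => c * U A B c n k))

def W (A B : ℕ → ℚ) (c : ℚ) (n : ℕ) : ℕ → ℚ := out (dl B) (fun k => c * U A B c n k)

theorem U_succ (A B : ℕ → ℚ) (c : ℚ) (n : ℕ) : U A B c (n + 1) = out (dl A) (W A B c n) := rfl

theorem U_nonneg {A B : ℕ → ℚ} (mA : Monotone A) (mB : Monotone B) {c : ℚ} (hc : 0 ≤ c)
    (n k : ℕ) : 0 ≤ U A B c n k := by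
  induction n generalizing k with
  | zero => exact dl_nonneg mA k
  | succ n ih =>
    exact out_nonneg (dl_nonneg mA)
      (out_nonneg (dl_nonneg mB) fun k => mul_nonneg hc (ih k)) k

theorem W_nonneg {A B : ℕ → ℚ} (mA : Monotone A) (mB : Monotone B) {c : ℚ} (hc : 0 ≤ c)
    (n k : ℕ) : 0 ≤ W A B c n k :=
  out_nonneg (dl_nonneg mB) (fun k => mul_nonneg hc (U_nonneg mA mB hc n k)) k

theorem W_sum_of {A B : ℕ → ℚ} (mA : Monotone A) (mB : Monotone B) {c : ℚ} (hc : 0 ≤ c)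
    (n N : ℕ) : ∑ k ∈ Finset.range N, W A B c n k ≤ c * ∑ k ∈ Finset.range N, U A B c n k := by
  rw [Finset.mul_sum]
  exact out_sum_le (fun k => mul_nonneg hc (U_nonneg mA mB hc n k)) N

theorem U_sum {A B : ℕ → ℚ} (mA : Monotone A) (mB : Monotone B) {c : ℚ} (hc : 0 ≤ c)
    (n N : ℕ) : ∑ k ∈ Finset.range N, U A B c n k ≤ c ^ n * (A N - A 0) := by
  induction n with
  | zero => simp only [U, dl, Finset.sum_range_sub, pow_zero, one_mul, le_refl]
  | succ n ih =>
    rw [U_succ]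
    refine (out_sum_le (W_nonneg mA mB hc n) N).trans ((W_sum_of mA mB hc n N).trans ?_)
    refine (mul_le_mul_of_nonneg_left ih hc).trans (le_of_eq ?_)
    ring

theorem W_sum {A B : ℕ → ℚ} (mA : Monotone A) (mB : Monotone B) {c : ℚ} (hc : 0 ≤ c)
    (n N : ℕ) : ∑ k ∈ Finset.range N, W A B c n k ≤ c ^ (n + 1) * (A N - A 0) := by
  refine (W_sum_of mA mB hc n N).trans ?_
  refine (mul_le_mul_of_nonneg_left (U_sum mA mB hc n N) hc).trans (le_of_eq ?_)
  ring

/-- pair of queue lengths coded at a natural number -/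
def EF (A B : ℕ → ℚ) (c : ℚ) (m : ℕ) : ℚ × ℚ :=
  (Q (dl A) (W A B c m.unpair.1) m.unpair.2,
    Q (dl B) (fun k => c * U A B c m.unpair.1 k) m.unpair.2)

/-- the step of the course-of-values recursion -/
def step (A B : ℕ → ℚ) (c : ℚ) (l : List (ℚ × ℚ)) : ℚ × ℚ :=
  let n := l.length.unpair.1
  let k := l.length.unpair.2
  let x := (l[Nat.pair n (k - 1)]?).getD (0, 0)
  let y := (l[Nat.pair (n - 1) (k - 1)]?).getD (0, 0)
  bif decide (k = 0) then (0, 0) else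
    (max (x.1 - dl A (k - 1)) 0 + min x.2 (dl B (k - 1)),
      max (x.2 - dl B (k - 1)) 0 +
        c * (bif decide (n = 0) then dl A (k - 1) else min y.1 (dl A (k - 1))))

theorem step_comp {A B : ℕ → ℚ} (cA : Computable A) (cB : Computable B) (c : ℚ) :
    Computable (step A B c) := by
  have cl : Computable fun l : List (ℚ × ℚ) => l.length.unpair :=
    Computable.unpair.comp Computable.list_length
  have cn : Computable fun l : List (ℚ × ℚ) => l.length.unpair.1 := Computable.fst.comp cl
  have ck : Computable fun l : List (ℚ × ℚ) => l.length.unpair.2 := Computable.snd.comp cl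
  have cn1 : Computable fun l : List (ℚ × ℚ) => l.length.unpair.1 - 1 := Computable.pred.comp cn
  have ck1 : Computable fun l : List (ℚ × ℚ) => l.length.unpair.2 - 1 := Computable.pred.comp ck
  have cp : Computable₂ Nat.pair := Primrec₂.natPair.to_comp
  have cx : Computable fun l : List (ℚ × ℚ) =>
      (l[Nat.pair l.length.unpair.1 (l.length.unpair.2 - 1)]?).getD (0, 0) :=
    Computable.option_getD (Computable.list_getElem?.comp Computable.id (cp.comp cn ck1))
      (Computable.const _)
  have cy : Computable fun l : List (ℚ × ℚ) =>
      (l[Nat.pair (l.length.unpair.1 - 1) (l.length.unpair.2 - 1)]?).getD (0, 0) :=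
    Computable.option_getD (Computable.list_getElem?.comp Computable.id (cp.comp cn1 ck1))
      (Computable.const _)
  have dA := (cdl cA).comp ck1
  have dB := (cdl cB).comp ck1
  refine Computable.cond (neq ck (Computable.const 0)) (Computable.const _) ?_
  refine Computable.pair ?_ ?_
  · exact qadd (qmax (qsub (Computable.fst.comp cx) dA) (Computable.const 0))
      (qmin (Computable.snd.comp cx) dB)
  · exact qadd (qmax (qsub (Computable.snd.comp cx) dB) (Computable.const 0))
      (qmul (Computable.const c) (Computable.cond (neq cn (Computable.const 0)) dA
        (qmin (Computable.fst.comp cy) dA)))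

theorem step_EF (A B : ℕ → ℚ) (c : ℚ) (m : ℕ) :
    step A B c ((List.range m).map (EF A B c)) = EF A B c m := by
  obtain ⟨n, k, rfl⟩ : ∃ n k, m = Nat.pair n k := ⟨_, _, (Nat.pair_unpair m).symm⟩
  cases k with
  | zero => simp [step, EF, Q]
  | succ k =>
    have h1 : Nat.pair n k < Nat.pair n (k + 1) := Nat.pair_lt_pair_right _ (Nat.lt_succ_self k)
    cases n with
    | zero => simp [step, EF, Q, h1, W, U, out]
    | succ n =>
      have h2 : Nat.pair n k < Nat.pair (n + 1) (k + 1) :=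
        (Nat.pair_lt_pair_left _ (Nat.lt_succ_self n)).trans h1
      simp [step, EF, Q, h1, h2, W, U, out]

theorem EF_comp {A B : ℕ → ℚ} (cA : Computable A) (cB : Computable B) (c : ℚ) :
    Computable (EF A B c) := by
  have h : Computable₂ (fun _ : Unit => EF A B c) := by
    refine Computable.nat_strong_rec _ (g := fun _ l => some (step A B c l)) ?_ ?_
    · exact Computable.option_some.comp ((step_comp cA cB c).comp Computable.snd)
    · intro _ m
      rw [step_EF]
  exact h.comp (Computable.const ()) Computable.id

theorem out_eq_of_lt {A v : ℕ → ℚ} (mA : Monotone A) {a : ℝ}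
    (tA : Tendsto (fun n => (A n : ℝ)) atTop (nhds a)) {N : ℕ}
    (h : a < A N + Q (dl A) v N) : out (dl A) v N = dl A N := by
  refine min_eq_right ?_
  have h1 := mono_le mA tA (N + 1)
  have h2 : ((A (N + 1) : ℚ) : ℝ) ≤ ((A N + Q (dl A) v N : ℚ) : ℝ) := by
    push_cast; linarith
  have h3 : A (N + 1) ≤ A N + Q (dl A) v N := by exact_mod_cast h2
  simp only [dl] at *
  linarith

theorem key {a b : ℝ} (ha : LeftCE a) (har : MLRandom a) (hb : LeftCE b) {c : ℚ}
    (hc0 : 0 < c) (hc1 : c < 1) : LeftCE (a - b) ∨ LeftCE (b - (c : ℝ) * a) := by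
  by_contra! hcon
  obtain ⟨n1, n2⟩ := hcon
  obtain ⟨A, cA, mA, tA⟩ := ha
  obtain ⟨B, cB, mB, tB⟩ := hb
  have la := mono_le mA tA
  obtain ⟨K0, hK0⟩ := exists_nat_ge (a - A 0)
  obtain ⟨k, hk⟩ := exists_pow_lt_of_lt_one (show (0:ℚ) < 1/2 by norm_num) hc1
  obtain ⟨m, hm⟩ := exists_pow_lt_of_lt_one (show (0:ℚ) < 1 / (K0 + 1) by positivity) hc1
  have t1 : Tendsto (fun n => ((A n - B n : ℚ) : ℝ)) atTop (nhds (a - b)) := by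
    simpa using tA.sub tB
  have t2 : Tendsto (fun n => ((B n - c * A n : ℚ) : ℝ)) atTop (nhds (b - (c : ℝ) * a)) := by
    simpa using tB.sub (tA.const_mul (c : ℝ))
  have tcA : Tendsto (fun n => ((c * A n : ℚ) : ℝ)) atTop (nhds ((c : ℝ) * a)) := by
    simpa using tA.const_mul (c : ℝ)
  have stepW : ∀ n, (∃ N0, ∀ N, N0 ≤ N → U A B c n N = dl A N) →
      ∃ N0, ∀ N, N0 ≤ N → a < A N + Q (dl A) (W A B c n) N := by
    rintro n ⟨N0, hN0⟩
    obtain ⟨s, hs, hlt⟩ := above_of_not_leftCE (qsub cB (qmul (Computable.const c) cA)) t2 n2 N0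
    obtain ⟨N1, hN1⟩ := queue_mem (A := B) (v := fun k => c * U A B c n k)
      (C := fun n => c * A n) (fun k => mul_nonneg hc0.le (U_nonneg mA mB hc0.le n k)) (a := b)
      (c := (c : ℝ) * a) (t := s)
      (fun k hk => by rw [hN0 k (hs.trans hk)]; simp only [dl]; rw [mul_sub]) tcA (by
        push_cast at hlt ⊢
        linarith)
    have hW : ∀ N, N1 ≤ N → W A B c n N = dl B N := fun N hN => out_eq_of_lt mB tB (hN1 N hN)
    obtain ⟨t, ht, hlt'⟩ := above_of_not_leftCE (qsub cA cB) t1 n1 N1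
    exact queue_mem (A := A) (v := W A B c n) (C := B) (W_nonneg mA mB hc0.le n) (a := a)
      (c := b) (t := t) (fun k hk => (hW k (ht.trans hk)).ge) tB (by
        push_cast at hlt'
        linarith)
  have hU : ∀ n, ∃ N0, ∀ N, N0 ≤ N → U A B c n N = dl A N := by
    intro n
    induction n with
    | zero => exact ⟨0, fun _ _ => rfl⟩
    | succ n ih =>
      obtain ⟨N0, hN0⟩ := stepW n ih
      exact ⟨N0, fun N hN => by rw [U_succ]; exact out_eq_of_lt mA tA (hN0 N hN)⟩
  refine queue_test cA mA tA (v := fun i => W A B c (k * i + m))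
    (fun i n => W_nonneg mA mB hc0.le _ n) ?_ ?_ ?_ har
  · have e : (fun p : ℕ × ℕ => Q (dl A) (W A B c (k * p.1 + m)) p.2) = fun p : ℕ × ℕ =>
        (EF A B c (Nat.pair (k * p.1 + m) p.2)).1 := by
      funext p; simp [EF]
    show Computable fun p : ℕ × ℕ => Q (dl A) (W A B c (k * p.1 + m)) p.2
    rw [e]
    have cp : Computable₂ Nat.pair := Primrec₂.natPair.to_comp
    exact Computable.fst.comp ((EF_comp cA cB c).comp (cp.comp
      (nadd (nmul (Computable.const k) Computable.fst) (Computable.const m)) Computable.snd))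
  · intro i N
    refine (W_sum mA mB hc0.le _ N).trans ?_
    have hA : A N - A 0 ≤ (K0 : ℚ) + 1 := by
      have h2 := la N
      have : ((A N - A 0 : ℚ) : ℝ) ≤ (((K0 : ℚ) + 1 : ℚ) : ℝ) := by push_cast; linarith
      exact_mod_cast this
    have hK : (0 : ℚ) < (K0 : ℚ) + 1 := by positivity
    have h3 : c ^ m * ((K0 : ℚ) + 1) ≤ 1 := by
      rw [lt_div_iff₀ hK] at hm; exact hm.le
    have h4 : (c ^ k) ^ i ≤ (1/2) ^ i := pow_le_pow_left₀ (by positivity) hk.le i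
    calc c ^ (k * i + m + 1) * (A N - A 0) ≤ c ^ (k * i + m + 1) * ((K0 : ℚ) + 1) :=
          mul_le_mul_of_nonneg_left hA (by positivity)
      _ ≤ c ^ (k * i + m) * ((K0 : ℚ) + 1) :=
          mul_le_mul_of_nonneg_right
            (pow_le_pow_of_le_one hc0.le hc1.le (Nat.le_succ _)) hK.le
      _ = (c ^ k) ^ i * (c ^ m * ((K0 : ℚ) + 1)) := by rw [pow_add, pow_mul]; ring
      _ ≤ (c ^ k) ^ i * 1 := mul_le_mul_of_nonneg_left h3 (by positivity)
      _ ≤ (1/2) ^ i := by rw [mul_one]; exact h4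
  · intro i
    obtain ⟨N0, hN0⟩ := stepW _ (hU (k * i + m))
    exact ⟨N0, hN0 N0 le_rfl⟩

theorem key2 {a b : ℝ} (ha : LeftCE a) (har : MLRandom a) (hb : LeftCE b) {q r : ℚ}
    (hq : 0 < q) (hqr : q < r) :
    LeftCE ((r : ℝ) * a - b) ∨ LeftCE (((1 / q : ℚ) : ℝ) * b - a) := by
  have hr : 0 < r := hq.trans hqr
  have hq' : (q : ℝ) ≠ 0 := by exact_mod_cast hq.ne'
  have hr' : (r : ℝ) ≠ 0 := by exact_mod_cast hr.ne'
  rcases key ha har (LeftCE.smul' hb (one_div_pos.2 hr).le) (div_pos hq hr)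
    ((div_lt_one hr).2 hqr) with h | h
  · left
    convert LeftCE.smul' h hr.le using 1
    push_cast; field_simp
  · right
    convert LeftCE.smul' h (div_pos hr hq).le using 1
    push_cast; field_simp

theorem prod_ge {a b : ℝ} (ha : LeftCE a) (har : MLRandom a) {p q : ℚ} (hp : 0 < p)
    (h1 : LeftCE ((q : ℝ) * a - b)) (h2 : LeftCE ((p : ℝ) * b - a)) : 1 ≤ q * p := by
  by_contra! hlt
  refine not_random_of_both ha ?_ har
  have h3 := LeftCE.add' (LeftCE.smul' h1 hp.le) h2
  have h0 : 0 < 1 - q * p := by linarith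
  have h0' : (1 : ℝ) - q * p ≠ 0 := by exact_mod_cast h0.ne'
  convert LeftCE.smul' h3 (one_div_pos.2 h0).le using 1
  push_cast; field_simp; ring

theorem main (a b : ℝ) (ha : LeftCE a) (har : MLRandom a)
    (hb : LeftCE b) (hbr : MLRandom b) : DD a b * DD b a = 1 := by
  obtain ⟨q0, hq0, hS0⟩ := kucera_slaman ha har hb
  obtain ⟨p0, hp0, hT0⟩ := kucera_slaman hb hbr ha
  set S : Set ℝ := {x : ℝ | ∃ q : ℚ, 0 < q ∧ x = (q : ℝ) ∧ LeftCE ((q : ℝ) * a - b)} with hS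
  set T : Set ℝ := {x : ℝ | ∃ q : ℚ, 0 < q ∧ x = (q : ℝ) ∧ LeftCE ((q : ℝ) * b - a)} with hT
  have eS : DD a b = sInf S := rfl
  have eT : DD b a = sInf T := rfl
  have neS : S.Nonempty := ⟨q0, q0, hq0, rfl, hS0⟩
  have neT : T.Nonempty := ⟨p0, p0, hp0, rfl, hT0⟩
  have pS : ∀ x ∈ S, 0 < x := by rintro x ⟨q, hq, rfl, -⟩; exact_mod_cast hq
  have pT : ∀ x ∈ T, 0 < x := by rintro x ⟨q, hq, rfl, -⟩; exact_mod_cast hq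
  have bS : BddBelow S := ⟨0, fun x hx => (pS x hx).le⟩
  have bT : BddBelow T := ⟨0, fun x hx => (pT x hx).le⟩
  have pr : ∀ x ∈ S, ∀ y ∈ T, 1 ≤ x * y := by
    rintro x ⟨q, hq, rfl, h1⟩ y ⟨p, hp, rfl, h2⟩
    exact_mod_cast prod_ge ha har hp h1 h2
  have hx0 : 0 < sInf S := by
    have hp0' : (0:ℝ) < p0 := by exact_mod_cast hp0
    refine lt_of_lt_of_le (one_div_pos.2 hp0') (le_csInf neS fun x hx => ?_)
    rw [div_le_iff₀ hp0']
    exact pr x hx _ ⟨p0, hp0, rfl, hT0⟩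
  have hge : 1 ≤ sInf S * sInf T := by
    have h1 : 1 / sInf S ≤ sInf T := by
      refine le_csInf neT fun y hy => ?_
      have hy0 := pT y hy
      rw [div_le_iff₀ hx0, mul_comm, ← div_le_iff₀ hy0]
      refine le_csInf neS fun x hx => ?_
      rw [div_le_iff₀ hy0]
      exact pr x hx y hy
    rw [div_le_iff₀ hx0] at h1
    linarith
  rw [eS, eT]
  refine le_antisymm ?_ hge
  by_contra! hgt
  have hy0 : 0 < sInf T := by
    by_contra! h
    nlinarith
  have h1 : 1 / sInf T < sInf S := by rwa [div_lt_iff₀ hy0]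
  obtain ⟨q, hq1, hq2⟩ := exists_rat_btwn h1
  obtain ⟨r, hr1, hr2⟩ := exists_rat_btwn hq2
  have hq0' : (0:ℝ) < q := (one_div_pos.2 hy0).trans hq1
  have hqp : 0 < q := by exact_mod_cast hq0'
  have hqr : q < r := by exact_mod_cast hr1
  rcases key2 ha har hb hqp hqr with h | h
  · exact absurd (csInf_le bS ⟨r, hqp.trans hqr, rfl, h⟩) (not_le.2 hr2)
  · have h2 : sInf T ≤ ((1 / q : ℚ) : ℝ) := csInf_le bT ⟨1 / q, one_div_pos.2 hqp, rfl, h⟩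
    push_cast at h2
    rw [le_div_iff₀ hq0'] at h2
    rw [div_lt_iff₀ hy0] at hq1
    linarith

end DMul

/-- If `α, β` are Martin-Löf random left-c.e. reals, then `D(α,β) · D(β,α) = 1`. -/
theorem D_mul_D_symm (a b : ℝ) (ha : LeftCE a) (har : MLRandom a)
    (hb : LeftCE b) (hbr : MLRandom b) :
    DD a b * DD b a = 1 := by
  exact DMul.main a b ha har hb hbr
end

section
/- If α and β are left-c.e. reals, α is Martin-Löf random, and p is a rational with p > 1, then either pα − β is a left-c.e. real, or else α − β is a right-c.e. real. -/
open Filter MeasureTheory Set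

namespace LCE
open Encodable

def eR (q : ℚ) : ℕ := @Encodable.encode ℚ Rat.instEncodable q

theorem eR_eq (q : ℚ) : eR q = Nat.pair (encode q.num) q.den := rfl

/-- the code of a rational -/
def eD (q : ℚ) : ℕ := @Encodable.encode ℚ Primcodable.toEncodable q

theorem encode_rat (q : ℚ) (d : DecidablePred (fun x => x ∈ Set.range (@Encodable.encode ℚ Rat.instEncodable))) : eD q = (List.range (eR q)).countP (fun x => @decide (x ∈ Set.range (@Encodable.encode ℚ Rat.instEncodable)) (d x)) := by
  have : d = @decidableRangeEncode ℚ _ := Subsingleton.elim _ _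
  subst this
  rfl

/-- positive part of the integer with code z -/
def zP (z : ℕ) : ℕ := if z % 2 = 0 then z / 2 else 0
def zN (z : ℕ) : ℕ := if z % 2 = 0 then 0 else z / 2 + 1

theorem z_spec (n : ℤ) : ((zP (encode n) : ℕ) : ℤ) - (zN (encode n) : ℕ) = n := by
  rcases n with n | n
  · have : encode (Int.ofNat n) = 2 * n := rfl
    rw [this]; simp [zP, zN]
  · have : encode (Int.negSucc n) = 2 * n + 1 := rfl
    rw [this]
    have h1 : (2 * n + 1) % 2 = 1 := by omega
    have h2 : (2 * n + 1) / 2 = n := by omega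
    simp [zP, zN, h1, h2, Int.negSucc_eq]

theorem z_natAbs (n : ℤ) : n.natAbs = zP (encode n) + zN (encode n) := by
  have h := z_spec n
  have : zP (encode n) = 0 ∨ zN (encode n) = 0 := by
    unfold zP zN; split_ifs <;> simp
  omega

theorem z_surj (z : ℕ) : ∃ n : ℤ, encode n = z :=
  ⟨Equiv.intEquivNat.symm z, Equiv.intEquivNat.apply_symm_apply z⟩

theorem zP_prim : Primrec zP :=
  Primrec.ite (Primrec.eq.comp (Primrec.nat_mod.comp .id (.const 2)) (.const 0))
    (Primrec.nat_div.comp .id (.const 2)) (.const 0)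

theorem zN_prim : Primrec zN :=
  Primrec.ite (Primrec.eq.comp (Primrec.nat_mod.comp .id (.const 2)) (.const 0))
    (.const 0) (Primrec.succ.comp (Primrec.nat_div.comp .id (.const 2)))

def gg (a d : ℕ) : ℕ := Nat.findGreatest (fun k => a % k = 0 ∧ d % k = 0) d

theorem gg_eq (a d : ℕ) (hd : 0 < d) : gg a d = Nat.gcd a d := by
  unfold gg
  rw [Nat.findGreatest_eq_iff]
  refine ⟨Nat.gcd_le_right _ hd, fun _ => ⟨Nat.mod_eq_zero_of_dvd (Nat.gcd_dvd_left _ _), Nat.mod_eq_zero_of_dvd (Nat.gcd_dvd_right _ _)⟩, ?_⟩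
  rintro k hk _ ⟨h1, h2⟩
  have := Nat.le_of_dvd (Nat.gcd_pos_of_pos_right _ hd) (Nat.dvd_gcd (Nat.dvd_of_mod_eq_zero h1) (Nat.dvd_of_mod_eq_zero h2))
  omega

theorem gg_prim : Primrec₂ gg := by
  have hr : PrimrecRel (fun (x : ℕ × ℕ) (k : ℕ) => x.1 % k = 0 ∧ x.2 % k = 0) := by
    refine PrimrecPred.and ?_ ?_
    · exact Primrec.eq.comp (Primrec.nat_mod.comp (Primrec.fst.comp .fst) .snd) (.const 0)
    · exact Primrec.eq.comp (Primrec.nat_mod.comp (Primrec.snd.comp .fst) .snd) (.const 0)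
  exact Primrec.nat_findGreatest (α := ℕ × ℕ) (f := fun x => x.2) Primrec.snd hr

def R (m : ℕ) : Prop := 0 < m.unpair.2 ∧ gg (zP m.unpair.1 + zN m.unpair.1) m.unpair.2 = 1

instance : DecidablePred R := fun m => by unfold R; infer_instance

theorem R_iff (m : ℕ) : R m ↔ m ∈ Set.range eR := by
  constructor
  · rintro ⟨h1, h2⟩
    obtain ⟨n, hn⟩ := z_surj m.unpair.1
    rw [gg_eq _ _ h1, ← hn, ← z_natAbs] at h2
    refine ⟨⟨n, m.unpair.2, h1.ne', h2⟩, ?_⟩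
    rw [eR_eq]; simp [hn]
  · rintro ⟨q, rfl⟩
    rw [R, eR_eq]
    simp only [Nat.unpair_pair]
    refine ⟨q.pos, ?_⟩
    rw [gg_eq _ _ q.pos, ← z_natAbs]; exact q.reduced

theorem R_prim : PrimrecPred R := by
  have u1 : Primrec (fun m : ℕ => m.unpair.1) := Primrec.fst.comp Primrec.unpair
  have u2 : Primrec (fun m : ℕ => m.unpair.2) := Primrec.snd.comp Primrec.unpair
  refine PrimrecPred.and ?_ ?_
  · exact Primrec.nat_lt.comp (.const 0) u2
  · exact Primrec.eq.comp (gg_prim.comp (Primrec.nat_add.comp (zP_prim.comp u1) (zN_prim.comp u1)) u2) (.const 1)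

def cnt (m : ℕ) : ℕ := Nat.rec 0 (fun y c => if R y then c + 1 else c) m

theorem cnt_eq (m : ℕ) : cnt m = (List.range m).countP (fun x => decide (R x)) := by
  induction m with
  | zero => rfl
  | succ m ih =>
    rw [List.range_succ, List.countP_append, ← ih]
    change (if R m then cnt m + 1 else cnt m) = _
    split_ifs with h <;> simp [h]

theorem cnt_prim : Primrec cnt := by
  refine Primrec.nat_rec' (f := fun m : ℕ => m) (g := fun _ => 0) (h := fun _ x => if R x.1 then x.2 + 1 else x.2) .id (.const 0) ?_
  have h2 : Primrec (fun x : ℕ × (ℕ × ℕ) => x.2.2) := Primrec.snd.comp .snd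
  exact Primrec.ite (R_prim.comp (Primrec.fst.comp .snd)) (Primrec.succ.comp h2) h2

theorem cnt_eR (q : ℚ) : cnt (eR q) = eD q := by
  classical
  rw [cnt_eq, encode_rat q (fun _ => Classical.dec _)]
  congr 1
  funext x
  rw [decide_eq_decide]
  exact R_iff x

theorem eR_comp : Computable eR := by
  have ex : ∀ q : ℚ, ∃ m, R m ∧ cnt m = eD q := fun q => ⟨eR q, (R_iff _).2 ⟨q, rfl⟩, cnt_eR q⟩
  have := Computable.find (P := fun (q : ℚ) m => R m ∧ cnt m = eD q) ?_ ex
  · refine this.of_eq fun q => ?_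
    obtain ⟨h1, h2⟩ := Nat.find_spec (ex q)
    obtain ⟨r, hr⟩ := (R_iff _).1 h1
    rw [← hr, cnt_eR] at h2
    have := @Encodable.encode_injective ℚ Primcodable.toEncodable _ _ h2
    subst this
    exact hr.symm
  · have : PrimrecPred (fun x : ℚ × ℕ => R x.2 ∧ cnt x.2 = eD x.1) :=
      (R_prim.comp .snd).and (Primrec.eq.comp (cnt_prim.comp .snd) (Primrec.encode.comp .fst))
    exact this.computablePred

def rP (q : ℚ) : ℕ := zP (eR q).unpair.1
def rN (q : ℚ) : ℕ := zN (eR q).unpair.1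

theorem rP_comp : Computable rP := zP_prim.to_comp.comp (Computable.fst.comp (Computable.unpair.comp eR_comp))
theorem rN_comp : Computable rN := zN_prim.to_comp.comp (Computable.fst.comp (Computable.unpair.comp eR_comp))
theorem den_comp : Computable (fun q : ℚ => q.den) :=
  (Computable.snd.comp (Computable.unpair.comp eR_comp)).of_eq fun q => by rw [eR_eq]; simp

theorem r_eq (q : ℚ) : q = ((rP q : ℚ) - rN q) / q.den := by
  have h := z_spec q.num
  have : ((rP q : ℚ) - rN q) = q.num := by
    rw [← h]; simp [rP, rN, eR_eq]
  rw [this, Rat.num_div_den]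

variable {α : Type*} [Primcodable α]

theorem cadd {f g : α → ℕ} (hf : Computable f) (hg : Computable g) : Computable fun a => f a + g a :=
  Primrec.nat_add.to_comp.comp hf hg
theorem cmul {f g : α → ℕ} (hf : Computable f) (hg : Computable g) : Computable fun a => f a * g a :=
  Primrec.nat_mul.to_comp.comp hf hg

theorem comp_of_frac {f : α → ℚ} {A B D : α → ℕ} (hA : Computable A) (hB : Computable B)
    (hD : Computable D) (hD0 : ∀ a, 0 < D a) (h : ∀ a, f a = ((A a : ℚ) - B a) / D a) :
    Computable f := by
  have key : ∀ (a : α) (r : ℚ), (rP r * D a + B a * r.den = A a * r.den + rN r * D a) ↔ r = f a := by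
    intro a r
    have h1 : (D a : ℚ) ≠ 0 := by exact_mod_cast (hD0 a).ne'
    have h2 : (r.den : ℚ) ≠ 0 := by exact_mod_cast r.den_ne_zero
    have h3 := r_eq r
    rw [h a]
    rw [show (r = ((A a : ℚ) - B a) / D a) ↔ (((rP r : ℚ) - rN r) / r.den = ((A a : ℚ) - B a) / D a) by rw [← h3]]
    rw [div_eq_div_iff h2 h1, ← @Nat.cast_inj ℚ]
    push_cast
    constructor <;> intro h <;> linarith
  let P : α → ℕ → Prop := fun a n =>
    rP (Denumerable.ofNat ℚ n) * D a + B a * (Denumerable.ofNat ℚ n).den = A a * (Denumerable.ofNat ℚ n).den + rN (Denumerable.ofNat ℚ n) * D a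
  have ex : ∀ a, ∃ n, P a n := fun a => ⟨eD (f a), by
    change _ = _
    rw [show Denumerable.ofNat ℚ (eD (f a)) = f a from Denumerable.ofNat_encode _]; exact (key a _).2 rfl⟩
  have dP : DecidableRel P := fun a n => by change Decidable (_ = _); infer_instance
  have cP : ComputablePred (fun x : α × ℕ => P x.1 x.2) := by
    have hq : Computable (fun x : α × ℕ => Denumerable.ofNat ℚ x.2) := (Computable.ofNat ℚ).comp .snd
    have e1 := cadd (cmul (rP_comp.comp hq) (hD.comp Computable.fst)) (cmul (hB.comp Computable.fst) (den_comp.comp hq))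
    have e2 := cadd (cmul (hA.comp Computable.fst) (den_comp.comp hq)) (cmul (rN_comp.comp hq) (hD.comp Computable.fst))
    have := (Primrec.beq (α := ℕ)).to_comp.comp e1 e2
    refine ⟨fun x => dP _ _, this.of_eq fun x => ?_⟩
    rw [Bool.beq_eq_decide_eq]
    exact decide_eq_decide.2 Iff.rfl
  have hc : Computable fun a => Denumerable.ofNat ℚ (Nat.find (ex a)) := (Computable.ofNat ℚ).comp (Computable.find cP ex)
  exact hc.of_eq fun a => (key a _).1 (Nat.find_spec (ex a))

theorem radd {f g : α → ℚ} (hf : Computable f) (hg : Computable g) : Computable fun a => f a + g a := by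
  have fp := rP_comp.comp hf; have fn := rN_comp.comp hf; have fd := den_comp.comp hf
  have gp := rP_comp.comp hg; have gn := rN_comp.comp hg; have gd := den_comp.comp hg
  refine comp_of_frac (cadd (cmul fp gd) (cmul gp fd)) (cadd (cmul fn gd) (cmul gn fd)) (cmul fd gd)
    (fun a => Nat.mul_pos (f a).pos (g a).pos) fun a => ?_
  have h1 : ((f a).den : ℚ) ≠ 0 := by exact_mod_cast (f a).den_ne_zero
  have h2 : ((g a).den : ℚ) ≠ 0 := by exact_mod_cast (g a).den_ne_zero
  conv_lhs => rw [r_eq (f a), r_eq (g a)]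
  push_cast
  field_simp
  ring

theorem rmul {f g : α → ℚ} (hf : Computable f) (hg : Computable g) : Computable fun a => f a * g a := by
  have fp := rP_comp.comp hf; have fn := rN_comp.comp hf; have fd := den_comp.comp hf
  have gp := rP_comp.comp hg; have gn := rN_comp.comp hg; have gd := den_comp.comp hg
  refine comp_of_frac (cadd (cmul fp gp) (cmul fn gn)) (cadd (cmul fn gp) (cmul fp gn)) (cmul fd gd)
    (fun a => Nat.mul_pos (f a).pos (g a).pos) fun a => ?_
  have h1 : ((f a).den : ℚ) ≠ 0 := by exact_mod_cast (f a).den_ne_zero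
  have h2 : ((g a).den : ℚ) ≠ 0 := by exact_mod_cast (g a).den_ne_zero
  conv_lhs => rw [r_eq (f a), r_eq (g a)]
  push_cast
  field_simp
  ring

theorem rsub {f g : α → ℚ} (hf : Computable f) (hg : Computable g) : Computable fun a => f a - g a :=
  (radd hf (rmul (Computable.const (-1)) hg)).of_eq fun a => by ring

theorem rle {f g : α → ℚ} (hf : Computable f) (hg : Computable g) :
    Computable fun a => decide (f a ≤ g a) := by
  have fp := rP_comp.comp hf; have fn := rN_comp.comp hf; have fd := den_comp.comp hf
  have gp := rP_comp.comp hg; have gn := rN_comp.comp hg; have gd := den_comp.comp hg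
  have := Primrec.nat_le.decide.to_comp.comp (cadd (cmul fp gd) (cmul gn fd)) (cadd (cmul gp fd) (cmul fn gd))
  refine this.of_eq fun a => ?_
  refine decide_eq_decide.2 ?_
  have h1 : (0 : ℚ) < (f a).den := by exact_mod_cast (f a).pos
  have h2 : (0 : ℚ) < (g a).den := by exact_mod_cast (g a).pos
  conv_rhs => rw [r_eq (f a), r_eq (g a)]
  rw [div_le_div_iff₀ h1 h2, ← @Nat.cast_le ℚ]
  push_cast
  constructor <;> intro h <;> linarith

theorem rmax {f g : α → ℚ} (hf : Computable f) (hg : Computable g) : Computable fun a => max (f a) (g a) :=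
  (Computable.cond (rle hf hg) hg hf).of_eq fun a => by
    by_cases h : f a ≤ g a
    · simp [h]
    · simp [h, le_of_not_ge h]

end LCE

namespace LCE

/-- running minimum of `max a x - b` and running maximum of `p a - b` since the last reset -/
def st (A B : ℕ → ℚ) (p x : ℚ) : ℕ → ℚ × ℚ := fun t =>
  Nat.rec (max (A 0) x - B 0, p * A 0 - B 0)
    (fun t s => bif decide (max (A (t + 1)) x - B (t + 1) ≤ s.1) then
        (max (A (t + 1)) x - B (t + 1), p * A (t + 1) - B (t + 1))
      else (s.1, max s.2 (p * A (t + 1) - B (t + 1)))) t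

def ch (A B : ℕ → ℚ) (p : ℚ) (I : ℚ × ℚ) (t : ℕ) : ℚ × ℚ :=
  bif decide (max (A (t + 1)) I.1 - B (t + 1) ≤ (st A B p I.1 t).1) || decide (I.2 ≤ A (t + 1)) then (0, 0)
  else (((st A B p I.1 t).2 + B t) * p⁻¹, ((st A B p I.1 t).2 + B (t + 1)) * p⁻¹)

def stp (A B : ℕ → ℚ) (p : ℚ) (c : (ℚ × ℚ) × ℕ) : (ℚ × ℚ) × ℕ :=
  (ch A B p c.1 c.2.unpair.1, c.2.unpair.2)

def cov (A B : ℕ → ℚ) (p : ℚ) (n : ℕ) (I : ℚ × ℚ) : Set ℝ :=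
  ⋃ m : ℕ, Set.Ioo ((((stp A B p)^[n] (I, m)).1.1 : ℚ) : ℝ) ((((stp A B p)^[n] (I, m)).1.2 : ℚ) : ℝ)

theorem st_comp {A B : ℕ → ℚ} (hA : Computable A) (hB : Computable B) (p : ℚ) :
    Computable (fun q : ℚ × ℕ => st A B p q.1 q.2) := by
  unfold st
  refine Computable.nat_rec (f := fun q : ℚ × ℕ => q.2)
    (g := fun q : ℚ × ℕ => (max (A 0) q.1 - B 0, p * A 0 - B 0))
    (h := fun (q : ℚ × ℕ) (ts : ℕ × (ℚ × ℚ)) => bif decide (max (A (ts.1 + 1)) q.1 - B (ts.1 + 1) ≤ ts.2.1) then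
        (max (A (ts.1 + 1)) q.1 - B (ts.1 + 1), p * A (ts.1 + 1) - B (ts.1 + 1))
      else (ts.2.1, max ts.2.2 (p * A (ts.1 + 1) - B (ts.1 + 1)))) Computable.snd ?_ ?_
  · exact (rsub (rmax (.const _) .fst) (.const _)).pair (.const _)
  · have ht : Computable (fun z : (ℚ × ℕ) × (ℕ × (ℚ × ℚ)) => z.2.1 + 1) :=
      Computable.succ.comp (Computable.fst.comp .snd)
    have hu : Computable (fun z : (ℚ × ℕ) × (ℕ × (ℚ × ℚ)) => z.2.2.1) :=
      Computable.fst.comp (Computable.snd.comp .snd)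
    have hs : Computable (fun z : (ℚ × ℕ) × (ℕ × (ℚ × ℚ)) => z.2.2.2) :=
      Computable.snd.comp (Computable.snd.comp .snd)
    have hx : Computable (fun z : (ℚ × ℕ) × (ℕ × (ℚ × ℚ)) => z.1.1) :=
      Computable.fst.comp .fst
    have h1 := rsub (rmax (hA.comp ht) hx) (hB.comp ht)
    have h2 := rsub (rmul (.const p) (hA.comp ht)) (hB.comp ht)
    exact Computable.cond (rle h1 hu) (h1.pair h2) (hu.pair (rmax hs h2))

theorem st_zero (A B : ℕ → ℚ) (p x : ℚ) : st A B p x 0 = (max (A 0) x - B 0, p * A 0 - B 0) := rfl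

theorem st_succ (A B : ℕ → ℚ) (p x : ℚ) (t : ℕ) : st A B p x (t + 1) =
    bif decide (max (A (t + 1)) x - B (t + 1) ≤ (st A B p x t).1) then
        (max (A (t + 1)) x - B (t + 1), p * A (t + 1) - B (t + 1))
      else ((st A B p x t).1, max (st A B p x t).2 (p * A (t + 1) - B (t + 1))) := rfl

attribute [irreducible] st

theorem st_succ_reset {A B : ℕ → ℚ} {p x : ℚ} {t : ℕ} (h : max (A (t + 1)) x - B (t + 1) ≤ (st A B p x t).1) :
    st A B p x (t + 1) = (max (A (t + 1)) x - B (t + 1), p * A (t + 1) - B (t + 1)) := by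
  rw [st_succ, decide_eq_true h, cond_true]

theorem st_succ_go {A B : ℕ → ℚ} {p x : ℚ} {t : ℕ} (h : ¬ max (A (t + 1)) x - B (t + 1) ≤ (st A B p x t).1) :
    st A B p x (t + 1) = ((st A B p x t).1, max (st A B p x t).2 (p * A (t + 1) - B (t + 1))) := by
  rw [st_succ, decide_eq_false h, cond_false]

theorem ch_reset {A B : ℕ → ℚ} {p : ℚ} {I : ℚ × ℚ} {t : ℕ}
    (h : max (A (t + 1)) I.1 - B (t + 1) ≤ (st A B p I.1 t).1) : ch A B p I t = (0, 0) := by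
  rw [ch, decide_eq_true h, Bool.true_or, cond_true]

theorem ch_out {A B : ℕ → ℚ} {p : ℚ} {I : ℚ × ℚ} {t : ℕ}
    (h : I.2 ≤ A (t + 1)) : ch A B p I t = (0, 0) := by
  rw [ch, decide_eq_true h, Bool.or_true, cond_true]

theorem ch_go {A B : ℕ → ℚ} {p : ℚ} {I : ℚ × ℚ} {t : ℕ}
    (h : ¬ max (A (t + 1)) I.1 - B (t + 1) ≤ (st A B p I.1 t).1) (h' : A (t + 1) < I.2) :
    ch A B p I t = (((st A B p I.1 t).2 + B t) * p⁻¹, ((st A B p I.1 t).2 + B (t + 1)) * p⁻¹) := by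
  rw [ch, decide_eq_false h, decide_eq_false (not_le.2 h'), Bool.or_false, cond_false]

theorem ch_comp {A B : ℕ → ℚ} (hA : Computable A) (hB : Computable B) (p : ℚ) :
    Computable (fun q : (ℚ × ℚ) × ℕ => ch A B p q.1 q.2) := by
  unfold ch
  have ht : Computable (fun q : (ℚ × ℚ) × ℕ => q.2) := Computable.snd
  have ht1 : Computable (fun q : (ℚ × ℚ) × ℕ => q.2 + 1) := Computable.succ.comp .snd
  have hx : Computable (fun q : (ℚ × ℚ) × ℕ => q.1.1) := Computable.fst.comp .fst
  have hy : Computable (fun q : (ℚ × ℚ) × ℕ => q.1.2) := Computable.snd.comp .fst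
  have hst : Computable (fun q : (ℚ × ℚ) × ℕ => st A B p q.1.1 q.2) := by
    have h := Computable.comp (f := fun q : ℚ × ℕ => st A B p q.1 q.2)
      (g := fun q : (ℚ × ℚ) × ℕ => (q.1.1, q.2)) (st_comp hA hB p) (hx.pair ht)
    exact h
  have hU : Computable (fun q : (ℚ × ℚ) × ℕ => (st A B p q.1.1 q.2).1) := Computable.fst.comp hst
  have hS : Computable (fun q : (ℚ × ℚ) × ℕ => (st A B p q.1.1 q.2).2) := Computable.snd.comp hst
  have a1 : Computable (fun q : (ℚ × ℚ) × ℕ => A (q.2 + 1)) := hA.comp ht1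
  have b1 : Computable (fun q : (ℚ × ℚ) × ℕ => B (q.2 + 1)) := hB.comp ht1
  have b0 : Computable (fun q : (ℚ × ℚ) × ℕ => B q.2) := hB.comp ht
  have c1 := rle (rsub (rmax a1 hx) b1) hU
  have c2 := rle hy a1
  have c3 := Primrec.or.to_comp.comp c1 c2
  have o1 := rmul (radd hS b0) (.const p⁻¹)
  have o2 := rmul (radd hS b1) (.const p⁻¹)
  exact Computable.cond c3 (.const (0, 0)) (o1.pair o2)

theorem stp_comp {A B : ℕ → ℚ} (hA : Computable A) (hB : Computable B) (p : ℚ) :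
    Computable (stp A B p) := by
  have hm : Computable (fun c : (ℚ × ℚ) × ℕ => c.2.unpair) := Computable.unpair.comp .snd
  exact ((ch_comp hA hB p).comp (Computable.fst.pair (Computable.fst.comp hm))).pair (Computable.snd.comp hm)

theorem iter_comp {A B : ℕ → ℚ} (hA : Computable A) (hB : Computable B) (p : ℚ) (I : ℚ × ℚ)
    {N : ℕ → ℕ} (hN : Computable N) :
    Computable (fun q : ℕ × ℕ => ((stp A B p)^[N q.1] (I, q.2)).1) := by
  have : Computable (fun q : ℕ × ℕ => (Nat.rec (I, q.2) (fun _ s => stp A B p s) (N q.1) : (ℚ × ℚ) × ℕ)) :=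
    Computable.nat_rec (f := fun q : ℕ × ℕ => N q.1) (g := fun q : ℕ × ℕ => (I, q.2))
      (h := fun _ s => stp A B p s.2) (hN.comp .fst) ((Computable.const _).pair .snd)
      ((stp_comp hA hB p).comp (Computable.snd.comp .snd))
  refine (Computable.fst.comp this).of_eq fun q => ?_
  congr 1
  generalize N q.1 = n
  induction n with
  | zero => rfl
  | succ n ih => rw [Function.iterate_succ_apply', ← ih]

theorem cov_zero (A B : ℕ → ℚ) (p : ℚ) (I : ℚ × ℚ) : cov A B p 0 I = Set.Ioo (I.1 : ℝ) (I.2 : ℝ) := by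
  simp only [cov, Function.iterate_zero, id_eq]
  exact Set.iUnion_const (ι := ℕ) _

theorem cov_succ (A B : ℕ → ℚ) (p : ℚ) (n : ℕ) (I : ℚ × ℚ) :
    cov A B p (n + 1) I = ⋃ t, cov A B p n (ch A B p I t) := by
  ext z
  simp only [cov, mem_iUnion, Function.iterate_succ_apply]
  constructor
  · rintro ⟨m, hm⟩
    exact ⟨m.unpair.1, m.unpair.2, hm⟩
  · rintro ⟨t, m, hm⟩
    exact ⟨Nat.pair t m, by simpa [stp] using hm⟩

section
variable {A B : ℕ → ℚ} {p : ℚ}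

theorem st_le (x : ℚ) (t : ℕ) : (st A B p x t).1 ≤ max (A t) x - B t := by
  cases t with
  | zero => rw [st_zero]
  | succ t =>
    by_cases h : max (A (t + 1)) x - B (t + 1) ≤ (st A B p x t).1
    · rw [st_succ_reset h]
    · rw [st_succ_go h]; exact (not_le.1 h).le

theorem ch_le (hBm : Monotone B) (hp : 0 < p) (I : ℚ × ℚ) (t : ℕ) :
    (ch A B p I t).1 ≤ (ch A B p I t).2 := by
  by_cases h : max (A (t + 1)) I.1 - B (t + 1) ≤ (st A B p I.1 t).1
  · rw [ch_reset h]
  by_cases h' : A (t + 1) < I.2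
  · rw [ch_go h h']
    have h1 := hBm (Nat.le_succ t)
    have h2 : 0 < p⁻¹ := inv_pos.2 hp
    exact mul_le_mul_of_nonneg_right (by linarith) h2.le
  · rw [ch_out (not_lt.1 h')]

theorem ch_sum (hAm : Monotone A) (hBm : Monotone B) (hp : 0 < p) (I : ℚ × ℚ) (hI : I.1 ≤ I.2) (T : ℕ) :
    (A T < I.2 → p * ∑ t ∈ Finset.range T, ((ch A B p I t).2 - (ch A B p I t).1) ≤ B T + (st A B p I.1 T).1 - I.1) ∧
    p * ∑ t ∈ Finset.range T, ((ch A B p I t).2 - (ch A B p I t).1) ≤ I.2 - I.1 := by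
  obtain ⟨x, y⟩ := I
  simp only at *
  induction T with
  | zero => simp [st_zero, hI]
  | succ T ih =>
    rw [Finset.sum_range_succ, mul_add]
    have hle := st_le (A := A) (B := B) (p := p) x T
    have hle' := st_le (A := A) (B := B) (p := p) x (T + 1)
    have hAT := hAm (Nat.le_succ T)
    have first : A (T + 1) < y → p * ∑ t ∈ Finset.range T, ((ch A B p (x, y) t).2 - (ch A B p (x, y) t).1) + p * ((ch A B p (x, y) T).2 - (ch A B p (x, y) T).1) ≤ B (T + 1) + (st A B p x (T + 1)).1 - x := by
      intro hy
      have ih1 := ih.1 (lt_of_le_of_lt hAT hy)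
      by_cases h : max (A (T + 1)) x - B (T + 1) ≤ (st A B p x T).1
      · rw [st_succ_reset h]
        rw [ch_reset (I := (x, y)) h]
        simp only
        have : max (A T) x ≤ max (A (T + 1)) x := max_le_max hAT le_rfl
        linarith
      · rw [st_succ_go h]
        have : ch A B p (x, y) T = (((st A B p x T).2 + B T) * p⁻¹, ((st A B p x T).2 + B (T + 1)) * p⁻¹) := ch_go (I := (x, y)) h hy
        rw [this]
        simp only
        have e : p * (((st A B p x T).2 + B (T + 1)) * p⁻¹ - ((st A B p x T).2 + B T) * p⁻¹) = B (T + 1) - B T := by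
          field_simp; ring
        rw [e]; linarith
    refine ⟨first, ?_⟩
    by_cases hy : A (T + 1) < y
    · have := first hy
      have : max (A (T + 1)) x ≤ y := max_le hy.le hI
      linarith
    · have : ch A B p (x, y) T = (0, 0) := ch_out (I := (x, y)) (not_lt.1 hy)
      rw [this]; simpa using ih.2

theorem cov_vol (hAm : Monotone A) (hBm : Monotone B) (hp : 0 < p) (n : ℕ) : ∀ (I : ℚ × ℚ), I.1 ≤ I.2 →
    volume (cov A B p n I) ≤ ENNReal.ofReal (((I.2 : ℝ) - I.1) * ((p : ℝ)⁻¹) ^ n) := by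
  have hp' : (0 : ℝ) < p := by exact_mod_cast hp
  induction n with
  | zero => intro I hI; rw [cov_zero]; simp
  | succ n ih =>
    intro I hI
    rw [cov_succ]
    refine (measure_iUnion_le _).trans ?_
    refine ENNReal.tsum_le_of_sum_range_le fun T => ?_
    refine (Finset.sum_le_sum fun t _ => ih _ (ch_le hBm hp I t)).trans ?_
    rw [← ENNReal.ofReal_sum_of_nonneg]
    · apply ENNReal.ofReal_le_ofReal
      rw [← Finset.sum_mul]
      have h := (ch_sum hAm hBm hp I hI T).2
      have h' : (p : ℝ) * ∑ t ∈ Finset.range T, (((ch A B p I t).2 : ℝ) - (ch A B p I t).1) ≤ I.2 - I.1 := by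
        exact_mod_cast h
      rw [pow_succ, mul_comm (((p : ℝ)⁻¹) ^ n), ← mul_assoc]
      refine mul_le_mul_of_nonneg_right ?_ (by positivity)
      rw [← div_eq_mul_inv, le_div_iff₀ hp', mul_comm]
      exact h'
    · intro t _
      have : ((ch A B p I t).1 : ℝ) ≤ (ch A B p I t).2 := by exact_mod_cast ch_le hBm hp I t
      have : 0 ≤ ((ch A B p I t).2 : ℝ) - (ch A B p I t).1 := by linarith
      positivity

end

theorem leftCE_rat (q : ℚ) : LeftCE (q : ℝ) := ⟨fun _ => q, .const q, monotone_const, tendsto_const_nhds⟩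

theorem cover_step {A B : ℕ → ℚ} {p : ℚ} {a b : ℝ} (hA : Computable A) (hB : Computable B)
    (hAm : Monotone A) (hBm : Monotone B)
    (ta : Tendsto (fun n => (A n : ℝ)) atTop (nhds a)) (tb : Tendsto (fun n => (B n : ℝ)) atTop (nhds b))
    (hp : 0 < p) (hirr : ∀ q : ℚ, a ≠ q)
    (hL : ¬ LeftCE ((p : ℝ) * a - b)) (hR : ¬ RightCE (a - b)) (I : ℚ × ℚ)
    (hI : a ∈ Set.Ioo (I.1 : ℝ) (I.2 : ℝ)) :
    ∃ t, a ∈ Set.Ioo ((ch A B p I t).1 : ℝ) ((ch A B p I t).2 : ℝ) := by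
  obtain ⟨x, y⟩ := I
  simp only at hI
  have hp' : (0 : ℝ) < p := by exact_mod_cast hp
  have hAa : ∀ t, (A t : ℝ) ≤ a := fun t =>
    Monotone.ge_of_tendsto (f := fun n => (A n : ℝ)) (fun i j h => Rat.cast_le.2 (hAm h)) ta t
  have hst : Computable (fun t => st A B p x t) := by
    have h := Computable.comp (f := fun q : ℚ × ℕ => st A B p q.1 q.2)
      (g := fun t : ℕ => (x, t)) (st_comp hA hB p) ((Computable.const x).pair .id)
    exact h
  have anti : Antitone (fun t => (st A B p x t).1) := by
    refine antitone_nat_of_succ_le fun t => ?_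
    by_cases h : max (A (t + 1)) x - B (t + 1) ≤ (st A B p x t).1
    · rw [st_succ_reset h]; exact h
    · rw [st_succ_go h]
  -- finitely many resets
  have fin1 : ∃ t0, ∀ t ≥ t0, ¬ max (A (t + 1)) x - B (t + 1) ≤ (st A B p x t).1 := by
    by_contra hcon
    push Not at hcon
    apply hR
    refine ⟨fun t => (st A B p x t).1, Computable.fst.comp hst, anti, ?_⟩
    have tm : Tendsto (fun n => (max (A n : ℝ) (x : ℝ) - B n : ℝ)) atTop (nhds (a - b)) := by
      have := (ta.max (tendsto_const_nhds (x := (x : ℝ)))).sub tb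
      rwa [max_eq_left hI.1.le] at this
    have hge : ∀ t, ((st A B p x t).1 : ℝ) ≤ max (A t : ℝ) x - B t := fun t => by
      exact_mod_cast st_le (A := A) (B := B) (p := p) x t
    have hanti : Antitone (fun t => ((st A B p x t).1 : ℝ)) := fun i j h => Rat.cast_le.2 (anti h)
    rw [Metric.tendsto_atTop] at tm ⊢
    intro ε hε
    obtain ⟨N, hN⟩ := tm ε hε
    refine ⟨N, fun n hn => ?_⟩
    obtain ⟨t, htn, ht⟩ := hcon n
    have e : ((st A B p x (t + 1)).1 : ℝ) = max (A (t + 1) : ℝ) x - B (t + 1) := by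
      rw [st_succ_reset ht]; push_cast; rfl
    have h1 := hN (t + 1) (by omega)
    have h2 := hN n hn
    have h3 := hanti (show n ≤ t + 1 by omega)
    have h4 := hge n
    simp only at h3
    rw [Real.dist_eq, abs_lt] at h1 h2 ⊢
    beta_reduce
    constructor <;> linarith [h1.1, h1.2, h2.1, h2.2]
  obtain ⟨t0, ht0⟩ := fin1
  -- finitely many updates
  have fin2 : ∃ t1, ∀ t ≥ t1, (st A B p x t).2 ≠ p * A t - B t := by
    by_contra hcon
    push Not at hcon
    apply hL
    have mono : Monotone (fun k => (st A B p x (t0 + k)).2) := by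
      refine monotone_nat_of_le_succ fun k => ?_
      rw [← add_assoc, st_succ_go (ht0 _ (by omega))]
      exact le_max_left _ _
    refine ⟨fun k => (st A B p x (t0 + k)).2, Computable.snd.comp (hst.comp (cadd (.const _) .id)), mono, ?_⟩
    have tm : Tendsto (fun n => (p * A n - B n : ℝ)) atTop (nhds (p * a - b)) := (ta.const_mul _).sub tb
    have hge : ∀ t ≥ t0 + 1, (p * A t - B t : ℝ) ≤ (st A B p x t).2 := fun t ht => by
      obtain ⟨t, rfl⟩ : ∃ s, t = s + 1 := ⟨t - 1, by omega⟩
      rw [st_succ_go (ht0 _ (by omega))]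
      exact_mod_cast le_max_right _ _
    have hmono : ∀ i j, t0 ≤ i → i ≤ j → ((st A B p x i).2 : ℝ) ≤ (st A B p x j).2 := fun i j h1 h2 => by
      have := mono (show i - t0 ≤ j - t0 by omega)
      simp only at this
      rw [Nat.add_sub_cancel' h1, Nat.add_sub_cancel' (h1.trans h2)] at this
      exact_mod_cast this
    rw [Metric.tendsto_atTop] at tm ⊢
    intro ε hε
    obtain ⟨N, hN⟩ := tm ε hε
    refine ⟨N + 1, fun n hn => ?_⟩
    obtain ⟨t, htn, ht⟩ := hcon (t0 + n)
    have e : ((st A B p x t).2 : ℝ) = p * A t - B t := by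
      rw [ht]; push_cast; rfl
    have h1 := hN t (by omega)
    have h2 := hN (t0 + n) (by omega)
    have h3 := hmono (t0 + n) t (by omega) htn
    have h4 := hge (t0 + n) (by omega)
    rw [Real.dist_eq, abs_lt] at h1 h2 ⊢
    beta_reduce
    constructor <;> linarith [h1.1, h1.2, h2.1, h2.2]
  -- last update
  obtain ⟨t1, hu, hlast⟩ : ∃ t1, (st A B p x t1).2 = p * A t1 - B t1 ∧ ∀ t > t1, (st A B p x t).2 ≠ p * A t - B t := by
    classical
    have h0 : (st A B p x 0).2 = p * A 0 - B 0 := by rw [st_zero]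
    have hpos : Nat.find fin2 ≠ 0 := fun h => Nat.find_spec fin2 0 (by omega) h0
    have hmin := Nat.find_min fin2 (m := Nat.find fin2 - 1) (by omega)
    push Not at hmin
    obtain ⟨t, ht, hte⟩ := hmin
    exact ⟨t, hte, fun s hs => Nat.find_spec fin2 s (by omega)⟩
  have nores : ∀ t ≥ t1, ¬ max (A (t + 1)) x - B (t + 1) ≤ (st A B p x t).1 := fun t ht h =>
    hlast (t + 1) (by omega) (by rw [st_succ_reset h])
  set S := (st A B p x t1).2 with hS
  have const : ∀ k, (st A B p x (t1 + k)).2 = S := by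
    intro k
    induction k with
    | zero => rfl
    | succ k ih =>
      have h := hlast (t1 + k + 1) (by omega)
      rw [← add_assoc]
      rw [st_succ_go (nores _ (by omega))] at h ⊢
      simp only [ih] at h ⊢
      rcases max_choice S (p * A (t1 + k + 1) - B (t1 + k + 1)) with e | e
      · exact e
      · exact absurd e h
  have const' : ∀ t ≥ t1, (st A B p x t).2 = S := fun t ht => by
    have := const (t - t1); rwa [Nat.add_sub_cancel' ht] at this
  have below : ∀ t > t1, (p * A t - B t : ℝ) ≤ S := by
    intro t ht
    obtain ⟨t, rfl⟩ : ∃ s, t = s + 1 := ⟨t - 1, by omega⟩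
    have h := const' (t + 1) (by omega)
    rw [st_succ_go (nores _ (by omega))] at h
    have := le_max_right (st A B p x t).2 (p * A (t + 1) - B (t + 1))
    simp only at h
    rw [h] at this
    exact_mod_cast this
  have hlim : (p : ℝ) * a - b ≤ S := by
    have tm : Tendsto (fun n => (p * A n - B n : ℝ)) atTop (nhds (p * a - b)) := (ta.const_mul _).sub tb
    exact le_of_tendsto tm (eventually_atTop.2 ⟨t1 + 1, fun t ht => below t (by omega)⟩)
  have hlt : (p : ℝ) * a - b < S := lt_of_le_of_ne hlim fun h => hL (h ▸ leftCE_rat S)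
  -- find the piece
  have ex : ∃ k, (p : ℝ) * a < S + B (t1 + k) := by
    have h := tb.eventually (lt_mem_nhds (show (p : ℝ) * a - S < b by linarith))
    obtain ⟨n, hn⟩ := (h.and (eventually_ge_atTop t1)).exists
    refine ⟨n - t1, ?_⟩
    rw [Nat.add_sub_cancel' hn.2]; linarith [hn.1]
  classical
  obtain ⟨k, hk, hk'⟩ : ∃ k, (p : ℝ) * a < S + B (t1 + k + 1) ∧ ¬ (p : ℝ) * a < S + B (t1 + k) := by
    have h0 : ¬ (p : ℝ) * a < S + B (t1 + 0) := by
      rw [hu]; push_cast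
      have := mul_le_mul_of_nonneg_left (hAa t1) hp'.le
      simp only [add_zero]
      linarith
    have hne : Nat.find ex ≠ 0 := fun h => h0 (h ▸ Nat.find_spec ex)
    refine ⟨Nat.find ex - 1, ?_, Nat.find_min ex (by omega)⟩
    have := Nat.find_spec ex
    rwa [show t1 + (Nat.find ex - 1) + 1 = t1 + Nat.find ex by omega]
  refine ⟨t1 + k, ?_⟩
  have hy : A (t1 + k + 1) < y := by
    have := lt_of_le_of_lt (hAa (t1 + k + 1)) hI.2
    exact_mod_cast this
  have hc : ch A B p (x, y) (t1 + k) = ((S + B (t1 + k)) * p⁻¹, (S + B (t1 + k + 1)) * p⁻¹) := by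
    rw [ch_go (I := (x, y)) (nores (t1 + k) (by omega)) hy]
    simp only [const k]
  rw [hc]
  constructor
  · refine lt_of_le_of_ne ?_ (hirr _).symm
    push_cast
    rw [← div_eq_mul_inv, div_le_iff₀ hp']
    linarith [not_lt.1 hk']
  · push_cast
    rw [← div_eq_mul_inv, lt_div_iff₀ hp']
    linarith

end LCE

theorem leftCE_or_rightCE (a b : ℝ) (ha : LeftCE a) (hb : LeftCE b) (har : MLRandom a)
    (p : ℚ) (hp : 1 < p) :
    LeftCE ((p : ℝ) * a - b) ∨ RightCE (a - b) := by
  by_contra hcon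
  push Not at hcon
  obtain ⟨hL, hR⟩ := hcon
  obtain ⟨A, hA, hAm, ta⟩ := ha
  obtain ⟨B, hB, hBm, tb⟩ := hb
  have hp0 : 0 < p := by linarith
  have hp1 : (1 : ℝ) < p := by exact_mod_cast hp
  have hirr : ∀ q : ℚ, a ≠ q := by
    rintro q rfl
    apply hR
    refine ⟨fun n => q - B n, LCE.rsub (.const q) hB, fun i j h => sub_le_sub_left (hBm h) q, ?_⟩
    have := (tendsto_const_nhds (x := (q : ℝ))).sub tb
    refine this.congr fun n => ?_
    push_cast; rfl
  obtain ⟨x, hx⟩ := exists_rat_lt a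
  obtain ⟨y, hy⟩ := exists_rat_gt a
  have hxy : x ≤ y := by exact_mod_cast (hx.trans hy).le
  have mem : ∀ (n : ℕ) (I : ℚ × ℚ), a ∈ Set.Ioo (I.1 : ℝ) (I.2 : ℝ) → a ∈ LCE.cov A B p n I := by
    intro n
    induction n with
    | zero => intro I hI; rw [LCE.cov_zero]; exact hI
    | succ n ih =>
      intro I hI
      rw [LCE.cov_succ]
      obtain ⟨t, ht⟩ := LCE.cover_step hA hB hAm hBm ta tb hp0 hirr hL hR I hI
      exact mem_iUnion.2 ⟨t, ih _ ht⟩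
  obtain ⟨K, hK⟩ := pow_unbounded_of_one_lt (2 : ℝ) hp1
  obtain ⟨J, hJ⟩ := pow_unbounded_of_one_lt ((y : ℝ) - x) (one_lt_two)
  let N : ℕ → ℕ := fun i => K * (i + J)
  have hN : Computable N := LCE.cmul (.const K) (LCE.cadd .id (.const J))
  let g : ℕ → ℕ → ℚ × ℚ := fun i m => ((LCE.stp A B p)^[N i] ((x, y), m)).1
  have hg : Computable₂ g := LCE.iter_comp hA hB p (x, y) hN
  have htest : ∀ i, testSet g i = LCE.cov A B p (N i) (x, y) := fun i => rfl
  obtain ⟨i, hi⟩ := har g hg (fun i => by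
    rw [htest]
    refine (LCE.cov_vol hAm hBm hp0 (N i) (x, y) hxy).trans ?_
    have e : (2⁻¹ : ENNReal) ^ i = ENNReal.ofReal ((2⁻¹ : ℝ) ^ i) := by
      rw [ENNReal.ofReal_pow (by norm_num), ENNReal.ofReal_inv_of_pos (by norm_num)]; norm_num
    rw [e]
    apply ENNReal.ofReal_le_ofReal
    have h1 : ((p : ℝ)⁻¹) ^ (N i) ≤ (2⁻¹ : ℝ) ^ (i + J) := by
      change ((p : ℝ)⁻¹) ^ (K * (i + J)) ≤ _
      rw [pow_mul]
      apply pow_le_pow_left₀ (by positivity)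
      rw [inv_pow]
      exact inv_anti₀ (by norm_num) hK.le
    calc ((y : ℝ) - x) * ((p : ℝ)⁻¹) ^ (N i) ≤ 2 ^ J * (2⁻¹ : ℝ) ^ (i + J) := by
          apply mul_le_mul hJ.le h1 (by positivity) (by positivity)
      _ = (2⁻¹ : ℝ) ^ i := by
          rw [pow_add, mul_comm, mul_assoc, ← mul_pow]; norm_num)
  exact hi (by rw [htest]; exact mem _ _ ⟨hx, hy⟩)
end
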